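/- arXiv:1501.06821 — 12 statements merged into one kernel-verified Lean document; each statement's English description precedes it below -/
import Mathlib

section
/- Let K be an algebraically closed field of characteristic zero, and let (x,M,N,d) ∈ K × ℤ³ with M ≥ 0, N ≥ 1, and d ≥ 2. Then there exists c ∈ K for which x has portrait (M,N) under f_{d,c} if and only if it is NOT the case that (x,M) = (0,1), and (x,M,N,d) is not one of (-1/2, 0, 2, 2), (1/2, 1, 2, 2), (1, 2, 2, 2), (-1, 2, 2, 2). -/
open Function

/-- `x` has (exact) preperiodic portrait `(M, N)` under the self-map `φ`:
`φ^[M+N] x = φ^[M] x`, with `M` the minimal preperiod and `N ≥ 1` the minimal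
eventual period. -/
def Portrait {K : Type*} (φ : K → K) (x : K) (M N : ℕ) : Prop :=
  0 < N ∧ φ^[M + N] x = φ^[M] x ∧
    (∀ m n : ℕ, 0 < n → φ^[m + n] x = φ^[m] x → M ≤ m) ∧
    (∀ n : ℕ, 0 < n → φ^[M + n] x = φ^[M] x → N ≤ n)

open Polynomial in
theorem rad_le {K : Type*} [Field K] [IsAlgClosed K] [CharZero K] [DecidableEq K] (a : K[X]) (ha : a ≠ 0) :
    (UniqueFactorizationMonoid.radical a).natDegree ≤ a.roots.toFinset.card := by
  have hs : Squarefree (UniqueFactorizationMonoid.radical a) :=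
    UniqueFactorizationMonoid.squarefree_radical
  have hsep := (PerfectField.separable_iff_squarefree).2 hs
  rw [(IsAlgClosed.splits (UniqueFactorizationMonoid.radical a)).natDegree_eq_card_roots,
    ← Multiset.toFinset_card_of_nodup (nodup_roots hsep)]
  apply Finset.card_le_card
  intro t ht
  rw [Multiset.mem_toFinset] at ht ⊢
  exact Multiset.mem_of_le (roots.le_of_dvd ha UniqueFactorizationMonoid.radical_dvd_self) ht

open Polynomial in
theorem key_count {K : Type*} [Field K] [IsAlgClosed K] [CharZero K] [DecidableEq K]
    (u B : K[X]) (d : ℕ) (hB : B ≠ 0) (h : B.natDegree < d * u.natDegree) :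
    d * u.natDegree + 1 ≤ u.natDegree + B.natDegree + (u ^ d + B).roots.toFinset.card := by
  have hu : u ≠ 0 := by rintro rfl; simp at h
  have hd : d ≠ 0 := by rintro rfl; simp at h
  have hA : u ^ d ≠ 0 := pow_ne_zero _ hu
  obtain ⟨g, a, b, hga, hgb, hab⟩ : ∃ g a b : K[X], u ^ d = g * a ∧ B = g * b ∧ IsCoprime a b := by
    obtain ⟨a, ha⟩ := EuclideanDomain.gcd_dvd_left (u ^ d) B
    obtain ⟨b, hb⟩ := EuclideanDomain.gcd_dvd_right (u ^ d) B
    refine ⟨_, a, b, ha, hb, ?_⟩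
    have hg : EuclideanDomain.gcd (u ^ d) B ≠ 0 := by
      intro h0; rw [h0, zero_mul] at hb; exact hB hb
    have := EuclideanDomain.gcd_eq_gcd_ab (u ^ d) B
    refine ⟨EuclideanDomain.gcdA (u ^ d) B, EuclideanDomain.gcdB (u ^ d) B, ?_⟩
    apply mul_left_cancel₀ hg
    generalize EuclideanDomain.gcdA (u ^ d) B = s at *
    generalize EuclideanDomain.gcdB (u ^ d) B = t at *
    generalize EuclideanDomain.gcd (u ^ d) B = g at *
    calc g * (s * a + t * b) = (g * a) * s + (g * b) * t := by ring
      _ = g * 1 := by rw [← ha, ← hb, mul_one, ← this]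
  have hg : g ≠ 0 := by rintro rfl; simp at hgb; exact hB hgb
  have ha : a ≠ 0 := by rintro rfl; simp at hga; exact hu hga.1
  have hb : b ≠ 0 := by rintro rfl; simp at hgb; exact hB hgb
  have hda : d * u.natDegree = g.natDegree + a.natDegree := by
    rw [← natDegree_mul hg ha, ← hga, natDegree_pow]
  have hdb : B.natDegree = g.natDegree + b.natDegree := by
    rw [← natDegree_mul hg hb, ← hgb]
  have hc : a + b ≠ 0 := by
    intro h0
    have : a = -b := eq_neg_of_add_eq_zero_left h0
    rw [this, natDegree_neg] at hda
    omega
  have habc := Polynomial.abc ha hb (neg_ne_zero.2 hc) hab (by ring)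
  have hcC : (a + b).roots.toFinset.card ≤ (u ^ d + B).roots.toFinset.card := by
    apply Finset.card_le_card
    apply Multiset.toFinset_subset.2
    apply Multiset.subset_of_le
    apply roots.le_of_dvd
    · rw [hga, hgb, ← mul_add]; exact mul_ne_zero hg hc
    · rw [hga, hgb, ← mul_add]; exact dvd_mul_left _ _
  have hau : a.roots.toFinset.card ≤ u.natDegree := by
    calc a.roots.toFinset.card ≤ u.roots.toFinset.card := by
          apply Finset.card_le_card
          intro t ht
          have h1 : t ∈ (u ^ d).roots :=
            Multiset.mem_of_le (roots.le_of_dvd hA (hga ▸ dvd_mul_left _ _)) (Multiset.mem_toFinset.1 ht)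
          rw [roots_pow] at h1
          exact Multiset.mem_toFinset.2 (Multiset.mem_of_mem_nsmul h1)
      _ ≤ Multiset.card u.roots := Multiset.toFinset_card_le _
      _ ≤ _ := card_roots' u
  have hbb : b.roots.toFinset.card ≤ b.natDegree :=
    (Multiset.toFinset_card_le _).trans (card_roots' b)
  have hrad := rad_le (a * b * -(a + b)) (mul_ne_zero (mul_ne_zero ha hb) (neg_ne_zero.2 hc))
  rw [roots_mul (mul_ne_zero (mul_ne_zero ha hb) (neg_ne_zero.2 hc)), roots_mul (mul_ne_zero ha hb),
    roots_neg, Multiset.toFinset_add, Multiset.toFinset_add] at hrad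
  have h1 := Finset.card_union_le (a.roots.toFinset ∪ b.roots.toFinset) (a + b).roots.toFinset
  have h2 := Finset.card_union_le a.roots.toFinset b.roots.toFinset
  rcases habc with ⟨h3, -⟩ | ⟨h3, -⟩
  · omega
  · have := derivative_eq_zero.1 h3
    omega

open Polynomial in
theorem avoid {K : Type*} [Field K] [DecidableEq K] (P Q : K[X]) (hQ : Q ≠ 0)
    (h : Q.natDegree < P.roots.toFinset.card) : ∃ t, P.eval t = 0 ∧ Q.eval t ≠ 0 := by
  by_contra! hh
  have : P.roots.toFinset ⊆ Q.roots.toFinset := by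
    intro t ht
    rw [Multiset.mem_toFinset] at ht ⊢
    exact (mem_roots hQ).2 (hh t (isRoot_of_mem_roots ht))
  have h1 := Finset.card_le_card this
  have h2 := (Multiset.toFinset_card_le Q.roots).trans (card_roots' Q)
  omega

theorem num_ineq (d N : ℕ) (hd : 2 ≤ d) (hN : 1 ≤ N) (h : 3 ≤ d ∨ 3 ≤ N) :
    ∑ n ∈ Finset.range (N / 2 + 1), d ^ n + 1 + d ^ (N - 1) ≤ d ^ N := by
  have hS := Nat.geomSum_eq hd (N / 2 + 1)
  have hS' : (∑ n ∈ Finset.range (N / 2 + 1), d ^ n) * (d - 1) + 1 = d ^ (N / 2 + 1) := by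
    have := geom_sum_mul_of_one_le (x := d) (by omega) (N / 2 + 1)
    have h1 : 1 ≤ d ^ (N / 2 + 1) := Nat.one_le_pow _ _ (by omega)
    omega
  obtain ⟨k, rfl⟩ : ∃ k, N = k + 1 := ⟨N - 1, by omega⟩
  generalize (∑ n ∈ Finset.range ((k + 1) / 2 + 1), d ^ n) = S at *
  simp only [Nat.add_sub_cancel]
  by_cases h3 : 3 ≤ d
  · have h1 : d ^ ((k + 1) / 2 + 1) ≤ d ^ (k + 1) := Nat.pow_le_pow_right (by omega) (by omega)
    have h2 : S * 2 ≤ S * (d - 1) := Nat.mul_le_mul_left _ (by omega)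
    have h4 : d ^ k * 3 ≤ d ^ (k + 1) := by rw [pow_succ]; exact Nat.mul_le_mul_left _ h3
    have h5 : 1 ≤ d ^ k := Nat.one_le_pow _ _ (by omega)
    omega
  · obtain rfl : d = 2 := by omega
    have h1 : 2 ^ ((k + 1) / 2 + 1) ≤ 2 ^ k := Nat.pow_le_pow_right (by omega) (by omega)
    rw [pow_succ 2 k]
    omega

theorem portrait_zero {K : Type*} (φ : K → K) (x : K) (N : ℕ) (hN : 0 < N) (h : φ^[N] x = x)
    (h' : ∀ n, 0 < n → n < N → n ∣ N → φ^[n] x ≠ x) : Portrait φ x 0 N := by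
  refine ⟨hN, by simpa using h, fun _ _ _ _ => Nat.zero_le _, fun n hn he => ?_⟩
  have hp : Function.IsPeriodicPt φ N x := h
  have hmp := hp.minimalPeriod_pos hN
  have hdvd := hp.minimalPeriod_dvd
  have h1 : Function.minimalPeriod φ x = N := by
    by_contra hne
    exact h' _ hmp (lt_of_le_of_ne (Nat.le_of_dvd hN hdvd) hne) hdvd
      (Function.isPeriodicPt_minimalPeriod φ x)
  have h2 : Function.IsPeriodicPt φ n x := by simpa [Function.IsPeriodicPt, Function.IsFixedPt] using he
  have := h2.minimalPeriod_le hn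
  omega

theorem portrait_succ {K : Type*} (φ : K → K) (x y : K) (M N : ℕ) (hN : 0 < N)
    (hy : φ y = φ (φ^[M] x)) (hne : y ≠ φ^[M] x) (h : φ^[N] y = y)
    (h' : ∀ n, 0 < n → n < N → n ∣ N → φ^[n] y ≠ y) : Portrait φ x (M + 1) N := by
  have hp := portrait_zero φ y N hN h h'
  have hit : ∀ k, φ^[M + 1 + k] x = φ^[k + 1] y := by
    intro k
    rw [show M + 1 + k = (k + 1) + M by omega, Function.iterate_add_apply,
      Function.iterate_succ_apply, Function.iterate_succ_apply, hy]
  have hit' : ∀ k, 0 < k → φ^[k] (φ^[M] x) = φ^[k] y := by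
    intro k hk
    obtain ⟨j, rfl⟩ : ∃ j, k = j + 1 := ⟨k - 1, by omega⟩
    rw [Function.iterate_succ_apply, Function.iterate_succ_apply, hy]
  have hper : ∀ k, φ^[k * N] y = y := by
    intro k
    have : Function.IsPeriodicPt φ N y := h
    exact this.const_mul k
  refine ⟨hN, ?_, ?_, ?_⟩
  · have := hit 0
    rw [hit, show M + 1 = M + 1 + 0 from rfl, hit, Function.iterate_add_apply,
      Function.iterate_add_apply]
    simp only [Function.iterate_one, Function.iterate_zero, id]
    rw [← Function.iterate_succ_apply, Function.iterate_succ_apply', h]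
  · intro m n hn he
    by_contra hlt
    have hw : φ^[n] (φ^[M] x) = φ^[M] x := by
      rw [← Function.iterate_add_apply, show n + M = (M - m) + (m + n) by omega,
        Function.iterate_add_apply, he, ← Function.iterate_add_apply]
      congr 2; omega
    have hw2 : φ^[N * n] (φ^[M] x) = φ^[M] x := by
      have : Function.IsPeriodicPt φ n (φ^[M] x) := hw
      exact this.const_mul N
    rw [hit' _ (Nat.mul_pos hN hn), Nat.mul_comm, hper] at hw2
    exact hne hw2
  · intro n hn he
    apply hp.2.2.2 n hn
    rw [hit, show M + 1 = M + 1 + 0 from rfl, hit] at he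
    have := congrArg (φ^[N - 1]) he
    rw [← Function.iterate_add_apply, ← Function.iterate_add_apply,
      show N - 1 + (n + 1) = n + N by omega, show N - 1 + (0 + 1) = N by omega,
      Function.iterate_add_apply, h] at this
    simpa using this

open Polynomial in
/-- iterates as polynomials in the parameter -/
noncomputable def itp {K : Type*} [Field K] (d : ℕ) (γ : K[X]) (x : K) (n : ℕ) : K[X] :=
  (fun z : K[X] => z ^ d + γ)^[n] (C x)

open Polynomial in
theorem itp_zero {K : Type*} [Field K] (d : ℕ) (γ : K[X]) (x : K) : itp d γ x 0 = C x := rfl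

open Polynomial in
theorem itp_succ {K : Type*} [Field K] (d : ℕ) (γ : K[X]) (x : K) (n : ℕ) :
    itp d γ x (n + 1) = itp d γ x n ^ d + γ := by
  unfold itp; rw [Function.iterate_succ_apply']

open Polynomial in
theorem itp_eval {K : Type*} [Field K] (d : ℕ) (γ : K[X]) (x : K) (n : ℕ) (t : K) :
    (itp d γ x n).eval t = (fun z => z ^ d + γ.eval t)^[n] x := by
  induction n with
  | zero => simp [itp_zero]
  | succ n ih => rw [itp_succ, Function.iterate_succ_apply', eval_add, eval_pow, ih]

open Polynomial in
theorem itp_natDegree {K : Type*} [Field K] (d : ℕ) (hd : 2 ≤ d) (γ : K[X]) (hγ : 1 ≤ γ.natDegree)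
    (x : K) (n : ℕ) : (itp d γ x (n + 1)).natDegree = γ.natDegree * d ^ n := by
  induction n with
  | zero =>
    rw [itp_succ, itp_zero, ← C_pow, natDegree_C_add]; simp
  | succ n ih =>
    have : γ.natDegree < (itp d γ x (n + 1) ^ d).natDegree := by
      rw [natDegree_pow, ih]
      have : 1 ≤ d ^ n := Nat.one_le_pow _ _ (by omega)
      have : γ.natDegree * 1 ≤ γ.natDegree * d ^ n := Nat.mul_le_mul_left _ this
      have : 2 * (γ.natDegree * d ^ n) ≤ d * (γ.natDegree * d ^ n) := Nat.mul_le_mul_right _ hd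
      omega
    rw [itp_succ, natDegree_add_eq_left_of_natDegree_lt this, natDegree_pow, ih, pow_succ]; ring

open Polynomial in
theorem itp_sub_natDegree {K : Type*} [Field K] (d : ℕ) (hd : 2 ≤ d) (x : K) (ζ : K) (m n : ℕ)
    (hn : 0 < n) :
    (itp d X x (m + 1 + n) - C ζ * itp d X x (m + 1)).natDegree = d ^ (m + n) := by
  have h1 : (itp d X x (m + 1 + n)).natDegree = d ^ (m + n) := by
    rw [show m + 1 + n = (m + n) + 1 by omega, itp_natDegree d hd X (by simp)]; simp
  have h2 : (itp d X x (m + 1)).natDegree = d ^ m := by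
    rw [itp_natDegree d hd X (by simp)]; simp
  have h3 : d ^ m < d ^ (m + n) := Nat.pow_lt_pow_right (by omega) (by omega)
  rw [natDegree_sub_eq_left_of_natDegree_lt, h1]
  exact (natDegree_C_mul_le _ _).trans_lt (by omega)

open Polynomial in
theorem exists_gen {K : Type*} [Field K] [IsAlgClosed K] [CharZero K] (x ζ : K) (m N d : ℕ)
    (hN : 1 ≤ N) (hd : 2 ≤ d) (h : 3 ≤ d ∨ 3 ≤ N) (hζ : ζ ≠ 1) :
    ∃ c : K, (fun z => z ^ d + c)^[m + 1 + N] x = ζ * (fun z => z ^ d + c)^[m + 1] x ∧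
      (fun z => z ^ d + c)^[m + 1] x ≠ 0 ∧
      ∀ n, 0 < n → n < N → n ∣ N →
        (fun z => z ^ d + c)^[m + 1 + n] x ≠ ζ * (fun z => z ^ d + c)^[m + 1] x := by
  classical
  set p := itp d (X : K[X]) x with hp
  have h2 : (p (m + 1)).natDegree = d ^ m := by
    rw [hp, itp_natDegree d hd X (by simp)]; simp
  have hu : (p (m + N)).natDegree = d ^ (m + N - 1) := by
    rw [hp, show m + N = (m + N - 1) + 1 by omega, itp_natDegree d hd X (by simp)]; simp
  have hdm : 1 ≤ d ^ m := Nat.one_le_pow _ _ (by omega)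
  set B : K[X] := X - C ζ * p (m + 1) with hB
  have hBd : B.natDegree ≤ d ^ m := by
    refine (natDegree_sub_le _ _).trans (max_le (by simpa using hdm) ?_)
    exact (natDegree_C_mul_le _ _).trans h2.le
  have hB0 : B ≠ 0 := by
    intro h0
    have h3 : X = C ζ * p (m + 1) := sub_eq_zero.1 h0
    rcases Nat.eq_zero_or_pos m with rfl | hm
    · rw [hp, itp_succ, itp_zero, ← C_pow] at h3
      generalize x ^ d = e at h3
      have := congrArg (fun q => coeff q 1) h3
      simp at this
      exact hζ this.symm
    · have hz : ζ ≠ 0 := by rintro rfl; simp at h3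
      have := congrArg natDegree h3
      rw [natDegree_C_mul hz, h2, natDegree_X] at this
      have : 1 < d ^ m := Nat.one_lt_pow (by omega) (by omega)
      omega
  have hdd : d * d ^ (m + N - 1) = d ^ m * d ^ N := by
    rw [← pow_succ', ← pow_add]; congr 1; omega
  have hdd' : d ^ (m + N - 1) = d ^ m * d ^ (N - 1) := by
    rw [← pow_add]; congr 1; omega
  have hlt : B.natDegree < d * (p (m + N)).natDegree := by
    rw [hu, hdd]
    have : 1 < d ^ N := Nat.one_lt_pow (by omega) (by omega)
    have : d ^ m * 1 < d ^ m * d ^ N := Nat.mul_lt_mul_of_pos_left this (by omega)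
    omega
  have hk := key_count (p (m + N)) B d hB0 hlt
  have hPe : p (m + N) ^ d + B = p (m + 1 + N) - C ζ * p (m + 1) := by
    rw [hB, show m + 1 + N = (m + N) + 1 by omega, hp, itp_succ d X x (m + N)]; ring
  rw [hPe, hu, hdd, hdd'] at hk
  have hni := num_ineq d N hd hN h
  set Q : K[X] := p (m + 1) * ∏ n ∈ Finset.range (N / 2),
    (p (m + 1 + (n + 1)) - C ζ * p (m + 1)) with hQ
  have hQn : ∀ n, p (m + 1 + (n + 1)) - C ζ * p (m + 1) ≠ 0 := by
    intro n h0
    have := itp_sub_natDegree d hd x ζ m (n + 1) (by omega)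
    rw [← hp, h0, natDegree_zero] at this
    have : 1 ≤ d ^ (m + (n + 1)) := Nat.one_le_pow _ _ (by omega)
    omega
  have hp0 : p (m + 1) ≠ 0 := by
    intro h0; rw [h0, natDegree_zero] at h2; omega
  have hQ0 : Q ≠ 0 := mul_ne_zero hp0 (Finset.prod_ne_zero_iff.2 fun n _ => hQn n)
  have hQd : Q.natDegree = d ^ m * ∑ n ∈ Finset.range (N / 2 + 1), d ^ n := by
    rw [hQ, natDegree_mul hp0 (Finset.prod_ne_zero_iff.2 fun n _ => hQn n), h2,
      natDegree_prod _ _ (fun n _ => hQn n), Finset.sum_range_succ', mul_add, Finset.mul_sum,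
      pow_zero, mul_one, add_comm]
    congr 1
    apply Finset.sum_congr rfl
    intro n _
    rw [hp, itp_sub_natDegree d hd x ζ m (n + 1) (by omega), pow_add]
  have hfin : Q.natDegree < (p (m + 1 + N) - C ζ * p (m + 1)).roots.toFinset.card := by
    rw [hQd]
    have := Nat.mul_le_mul_left (d ^ m) hni
    rw [mul_add, mul_add] at this
    omega
  obtain ⟨c, hc, hc'⟩ := avoid _ _ hQ0 hfin
  have hev : ∀ n, (p n).eval c = (fun z => z ^ d + c)^[n] x := by
    intro n; rw [hp, itp_eval]; simp
  rw [hQ, eval_mul, eval_prod] at hc'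
  refine ⟨c, ?_, ?_, ?_⟩
  · rw [← hev, ← hev]
    rw [eval_sub, eval_mul, eval_C] at hc
    exact sub_eq_zero.1 hc
  · rw [← hev]; exact left_ne_zero_of_mul hc'
  · intro n hn hnN hdvd he
    have h3 := Finset.prod_ne_zero_iff.1 (right_ne_zero_of_mul hc') (n - 1) (by
      rw [Finset.mem_range]
      obtain ⟨k, rfl⟩ := hdvd
      have : 2 ≤ k := by
        by_contra hk
        interval_cases k <;> omega
      have : n * 2 ≤ n * k := Nat.mul_le_mul_left _ this
      omega)
    apply h3
    rw [Nat.sub_add_cancel hn, eval_sub, eval_mul, eval_C, hev, hev, he, sub_self]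

open Polynomial in
theorem exists_per {K : Type*} [Field K] [IsAlgClosed K] [CharZero K] (x : K) (N d : ℕ)
    (hN : 1 ≤ N) (hd : 2 ≤ d) (h : ¬ (x = -(1/2) ∧ N = 2 ∧ d = 2)) :
    ∃ c : K, (fun z => z ^ d + c)^[N] x = x ∧
      ∀ n, 0 < n → n < N → n ∣ N → (fun z => z ^ d + c)^[n] x ≠ x := by
  classical
  by_cases hN1 : N = 1
  · subst hN1
    exact ⟨x - x ^ d, by simp, fun n _ _ => by omega⟩
  by_cases h2 : N = 2 ∧ d = 2
  · obtain ⟨rfl, rfl⟩ := h2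
    refine ⟨-(x ^ 2 + x + 1), ?_, ?_⟩
    · simp [Function.iterate_succ]; ring
    · intro n hn hn2 _
      obtain rfl : n = 1 := by omega
      simp only [Function.iterate_one]
      intro h0
      apply h
      refine ⟨?_, rfl, rfl⟩
      linear_combination (-1/2) * h0
  have h3 : 3 ≤ d ∨ 3 ≤ N := by omega
  obtain ⟨k, rfl⟩ : ∃ k, N = k + 2 := ⟨N - 2, by omega⟩
  set p := itp d (X : K[X]) x with hp
  have hpd : ∀ n, (p (n + 1)).natDegree = d ^ n := by
    intro n; rw [hp, itp_natDegree d hd X (by simp)]; simp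
  have hBd : (X - C x : K[X]).natDegree = 1 := natDegree_X_sub_C x
  have hk := key_count (p (k + 1)) (X - C x) d (X_sub_C_ne_zero x) (by
    rw [hBd, hpd]
    have : 1 ≤ d ^ k := Nat.one_le_pow _ _ (by omega)
    nlinarith)
  have hPe : p (k + 1) ^ d + (X - C x) = p (k + 2) - C x := by
    rw [hp, itp_succ _ _ _ (k + 1)]; ring
  rw [hPe, hBd, hpd, ← pow_succ'] at hk
  have hni := num_ineq d (k + 2) hd hN h3
  set Q : K[X] := ∏ n ∈ Finset.range ((k + 2) / 2), (p (n + 1) - C x) with hQ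
  have hQn : ∀ n, p (n + 1) - C x ≠ 0 := by
    intro n h0
    have h1 := hpd n
    rw [sub_eq_zero.1 h0, natDegree_C] at h1
    have : 1 ≤ d ^ n := Nat.one_le_pow _ _ (by omega)
    omega
  have hQ0 : Q ≠ 0 := (Finset.prod_ne_zero_iff.2 fun n _ => hQn n)
  have hQd : Q.natDegree = ∑ n ∈ Finset.range ((k + 2) / 2), d ^ n := by
    rw [hQ, natDegree_prod _ _ (fun n _ => hQn n)]
    apply Finset.sum_congr rfl
    intro n _
    rw [natDegree_sub_C, hpd]
  rw [Finset.sum_range_succ', ] at hni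
  have hfin : Q.natDegree < (p (k + 2) - C x).roots.toFinset.card := by
    rw [hQd]
    simp only [pow_succ, ← Finset.sum_mul, pow_zero, show k + 2 - 1 = k + 1 from rfl] at hni hk
    by_contra hcon
    have h5 : d ^ k * d ≤ d ^ k + ∑ n ∈ Finset.range ((k + 2) / 2), d ^ n := by omega
    have := Nat.mul_le_mul_right d h5
    rw [add_mul] at this
    omega
  obtain ⟨c, hc, hc'⟩ := avoid _ _ hQ0 hfin
  have hev : ∀ n, (p n).eval c = (fun z => z ^ d + c)^[n] x := by
    intro n; rw [hp, itp_eval]; simp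
  rw [hQ, eval_prod] at hc'
  refine ⟨c, ?_, ?_⟩
  · rw [← hev]
    rw [eval_sub, eval_C] at hc
    exact sub_eq_zero.1 hc
  · intro n hn hnN hdvd he
    have h3 := Finset.prod_ne_zero_iff.1 hc' (n - 1) (by
      rw [Finset.mem_range]
      obtain ⟨j, hj⟩ := hdvd
      have : 2 ≤ j := by
        by_contra hk
        interval_cases j <;> omega
      have : n * 2 ≤ n * j := Nat.mul_le_mul_left _ this
      omega)
    apply h3
    rw [Nat.sub_add_cancel hn, eval_sub, eval_C, hev, he, sub_self]

open Polynomial in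
/-- d = 2, N = 1 -/
theorem exists_two_one {K : Type*} [Field K] [IsAlgClosed K] [CharZero K] (x : K) (m : ℕ) :
    ∃ t : K, t ≠ 0 ∧ (fun z => z ^ 2 + (t - t ^ 2))^[m + 1] x = -t := by
  set γ : K[X] := X - X ^ 2 with hγ
  have hγd : γ.natDegree = 2 := by rw [hγ]; compute_degree!
  set p := itp 2 γ x with hp
  have hpd : ∀ n, (p (n + 1)).natDegree = 2 * 2 ^ n := by
    intro n; rw [hp, itp_natDegree 2 le_rfl γ (by omega), hγd]
  have hP : (p (m + 1) + X).natDegree = 2 * 2 ^ m := by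
    rw [natDegree_add_eq_left_of_natDegree_lt, hpd]
    rw [hpd, natDegree_X]
    have : 1 ≤ 2 ^ m := Nat.one_le_two_pow
    omega
  have h1m : 1 ≤ 2 ^ m := Nat.one_le_two_pow
  have hev : ∀ n t, (p n).eval t = (fun z => z ^ 2 + (t - t ^ 2))^[n] x := by
    intro n t; rw [hp, itp_eval, hγ]; simp
  have key : ∃ t : K, t ≠ 0 ∧ (p (m + 1) + X).eval t = 0 := by
    by_cases h0 : (p (m + 1) + X).eval 0 = 0
    · have hs : p (m + 1) + X = p m ^ 2 + (2 * X - X ^ 2) := by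
        rw [hp, itp_succ, hγ]; ring
      have hu : (p m).eval 0 = 0 := by
        rw [hs] at h0; simpa using h0
      obtain ⟨s, hs'⟩ := (dvd_iff_isRoot (p := p m) (a := 0)).2 hu
      rw [C_0, sub_zero] at hs'
      have hf : p (m + 1) + X = X * (X * s ^ 2 + 2 - X) := by
        rw [hs, hs']; ring
      set R := X * s ^ 2 + 2 - X with hR
      have hR0 : R ≠ 0 := by
        intro h; rw [h, mul_zero] at hf; rw [hf, natDegree_zero] at hP; omega
      have hRd : R.degree ≠ 0 := by
        intro h
        have := natDegree_eq_zero_iff_degree_le_zero.2 h.le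
        rw [hf, natDegree_mul X_ne_zero hR0, natDegree_X, this] at hP
        omega
      obtain ⟨t, ht⟩ := IsAlgClosed.exists_root R hRd
      refine ⟨t, ?_, ?_⟩
      · rintro rfl
        rw [IsRoot, hR] at ht
        simp at ht
      · rw [hf, eval_mul, ht.eq_zero, mul_zero]
    · obtain ⟨t, ht⟩ := IsAlgClosed.exists_root (p (m + 1) + X) (by
        intro h
        have := natDegree_eq_zero_iff_degree_le_zero.2 h.le
        omega)
      refine ⟨t, ?_, ht⟩
      rintro rfl
      exact h0 ht
  obtain ⟨t, ht, he⟩ := key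
  refine ⟨t, ht, ?_⟩
  rw [eval_add, eval_X, hev] at he
  exact eq_neg_of_add_eq_zero_left he

open Polynomial in
/-- d = 2, N = 2 -/
theorem exists_two_two {K : Type*} [Field K] [IsAlgClosed K] [CharZero K] (x : K) (m : ℕ)
    (hx : ¬ (m = 0 ∧ (x = 1 ∨ x = -1))) :
    ∃ t : K, t ≠ 0 ∧ t ≠ -(1/2) ∧ (fun z => z ^ 2 + -(t ^ 2 + t + 1))^[m + 1] x = -t := by
  classical
  rcases Nat.lt_or_ge m 1 with hm | hm
  · obtain rfl : m = 0 := by omega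
    obtain ⟨s, hs⟩ := IsAlgClosed.exists_pow_nat_eq (x ^ 2 - 1) (n := 2) (by norm_num)
    have hs0 : s ≠ 0 := by
      rintro rfl
      apply hx
      refine ⟨rfl, ?_⟩
      rw [← sq_eq_sq_iff_eq_or_eq_neg]
      linear_combination -hs
    by_cases h : s = -(1/2)
    · refine ⟨-s, by simpa using hs0, ?_, ?_⟩
      · rw [h]; norm_num
      · simp; linear_combination -hs
    · refine ⟨s, hs0, h, ?_⟩
      simp; linear_combination -hs
  set γ : K[X] := -(X ^ 2 + X + 1) with hγ
  have hγd : γ.natDegree = 2 := by rw [hγ, natDegree_neg]; compute_degree!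
  set p := itp 2 γ x with hp
  have hpd : ∀ n, (p (n + 1)).natDegree = 2 * 2 ^ n := by
    intro n; rw [hp, itp_natDegree 2 le_rfl γ (by omega), hγd]
  have hev : ∀ n t, (p n).eval t = (fun z => z ^ 2 + -(t ^ 2 + t + 1))^[n] x := by
    intro n t; rw [hp, itp_eval, hγ]; simp
  have hs : p (m + 1) + X = p m ^ 2 + (-X ^ 2 - 1) := by
    rw [hp, itp_succ, hγ]; ring
  have key : ∃ t : K, t ≠ 0 ∧ t ≠ -(1/2) ∧ (p (m + 1) + X).eval t = 0 := by
    rcases Nat.lt_or_ge m 2 with hm2 | hm2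
    · obtain rfl : m = 1 := by omega
      by_contra! hcon
      have hP4 : p 2 + X = X ^ 4 + 2 * X ^ 3 + C (2 - 2 * x ^ 2) * X ^ 2 + C (2 - 2 * x ^ 2) * X + C (x ^ 4 - 2 * x ^ 2) := by
        rw [hs, hp, itp_succ, itp_zero, hγ]
        simp only [map_sub, map_mul, map_pow, map_ofNat]
        ring
      have hev2 : ∀ t, (p 2 + X).eval t = t ^ 4 + 2 * t ^ 3 + (2 - 2 * x ^ 2) * t ^ 2 + (2 - 2 * x ^ 2) * t + (x ^ 4 - 2 * x ^ 2) := by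
        intro t; rw [hP4]; simp
      have hd4 : (p 2 + X).natDegree = 4 := by rw [hP4]; compute_degree!
      have hm4 : (p 2 + X).Monic := by
        rw [hP4]; monicity!
      have hpr := (IsAlgClosed.splits (p 2 + X)).eq_prod_roots_of_monic hm4
      have hone : ∃ r : K, ∀ t ∈ (p 2 + X).roots, t = r := by
        by_cases h0 : (p 2 + X).eval 0 = 0
        · refine ⟨0, fun t ht => ?_⟩
          by_contra ht0
          have ht1 : t = -(1/2) := by
            by_contra h1
            exact hcon t ht0 h1 (isRoot_of_mem_roots ht)
          have h2 : (p 2 + X).eval t = 0 := isRoot_of_mem_roots ht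
          rw [hev2] at h0 h2
          rw [ht1] at h2
          have hA : x ^ 2 * (x ^ 2 - 2) = 0 := by linear_combination h0
          have hB : x ^ 2 = 11/8 := by
            linear_combination 2 * h2 - 2 * h0
          rw [hB] at hA
          norm_num at hA
        · refine ⟨-(1/2), fun t ht => ?_⟩
          by_contra ht0
          refine hcon t ?_ ht0 (isRoot_of_mem_roots ht)
          rintro rfl
          exact h0 (isRoot_of_mem_roots ht)
      obtain ⟨r, hr⟩ := hone
      have hcard : Multiset.card (p 2 + X).roots = 4 := by
        rw [← (IsAlgClosed.splits (p 2 + X)).natDegree_eq_card_roots, hd4]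
      rw [Multiset.eq_replicate.2 ⟨hcard, hr⟩] at hpr
      simp at hpr
      have hall : ∀ t, (p 2 + X).eval t = (t - r) ^ 4 := by
        intro t; rw [hpr]; simp; ring
      simp only [hev2] at hall
      have e0 := hall 0
      have e1 := hall 1
      have e2 := hall (-1)
      have e3 := hall 2
      have e4 := hall (-2)
      have hr2 : r = -(1/2) := by
        linear_combination (1/48) * (e3 - e4 - 2 * e1 + 2 * e2)
      subst hr2
      have f1 : x ^ 2 = 1/4 := by linear_combination (-1/4) * (e1 + e2 - 2 * e0)
      have f2 : x ^ 2 = 3/4 := by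
        linear_combination (-1/4) * (e1 - e2)
      rw [f1] at f2; norm_num at f2
    · obtain ⟨k, rfl⟩ : ∃ k, m = k + 2 := ⟨m - 2, by omega⟩
      have hBd : (-X ^ 2 - 1 : K[X]).natDegree = 2 := by compute_degree!
      have hB0 : (-X ^ 2 - 1 : K[X]) ≠ 0 := by
        intro h; rw [h] at hBd; simp at hBd
      have h1k : 1 ≤ 2 ^ k := Nat.one_le_two_pow
      have hk := key_count (p (k + 2)) (-X ^ 2 - 1) 2 hB0 (by
        rw [hBd, hpd, pow_succ]; omega)
      rw [← hs, hBd, hpd, pow_succ] at hk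
      obtain ⟨t, ht, ht'⟩ := avoid (p (k + 2 + 1) + X) (X * (X + C (1/2))) 
        (mul_ne_zero X_ne_zero (X_add_C_ne_zero _)) (by
          rw [natDegree_mul X_ne_zero (X_add_C_ne_zero _), natDegree_X, natDegree_X_add_C]
          omega)
      rw [eval_mul, eval_X, eval_add, eval_X, eval_C] at ht'
      refine ⟨t, left_ne_zero_of_mul ht', ?_, ht⟩
      rintro h
      apply right_ne_zero_of_mul ht'
      rw [h]; ring
  obtain ⟨t, ht, ht', he⟩ := key
  refine ⟨t, ht, ht', ?_⟩
  rw [eval_add, eval_X, hev] at he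
  exact eq_neg_of_add_eq_zero_left he

theorem main_portrait_realization (K : Type*) [Field K] [IsAlgClosed K] [CharZero K]
    (x : K) (M N d : ℕ) (hN : 1 ≤ N) (hd : 2 ≤ d) :
    (∃ c : K, Portrait (fun z => z ^ d + c) x M N) ↔
      (¬(x = 0 ∧ M = 1) ∧
       ¬(x = -(1 / 2 : K) ∧ M = 0 ∧ N = 2 ∧ d = 2) ∧
       ¬(x = (1 / 2 : K) ∧ M = 1 ∧ N = 2 ∧ d = 2) ∧
       ¬(x = 1 ∧ M = 2 ∧ N = 2 ∧ d = 2) ∧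
       ¬(x = -1 ∧ M = 2 ∧ N = 2 ∧ d = 2)) := by
  constructor
  · rintro ⟨c, -, h1, h2, h3⟩
    have aux : ∀ y : K, y ^ 2 = 1 → M = 2 → N = 2 → d = 2 → x = y → False := by
      rintro y hy rfl rfl rfl rfl
      have k1 : ((1 + c) ^ 2 + c) ^ 2 + c ≠ 1 + c := fun h =>
        absurd (h2 1 2 (by norm_num) (by simpa [Function.iterate_succ, hy] using h)) (by norm_num)
      have k2 : ((1 + c) ^ 2 + c) ^ 2 + c ≠ (1 + c) ^ 2 + c := fun h =>
        absurd (h3 1 (by norm_num) (by simpa [Function.iterate_succ, hy] using h)) (by norm_num)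
      simp [Function.iterate_succ, hy] at h1
      have g1 : ((1 + c) ^ 2 + c) ^ 2 + c + (1 + c) = 0 := by
        apply mul_left_cancel₀ (sub_ne_zero.2 k1)
        linear_combination h1
      have g3 : (1 + c) - ((1 + c) ^ 2 + c) = 1 := by
        apply mul_left_cancel₀ (sub_ne_zero.2 k2)
        linear_combination ((1 + c) - ((1 + c) ^ 2 + c)) * g1
      have g4 : 1 + c = 0 := by
        apply pow_eq_zero_iff (two_ne_zero) |>.1
        linear_combination -g3
      apply k1
      linear_combination g1 - 2 * g4
    refine ⟨?_, ?_, ?_, ?_, ?_⟩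
    · rintro ⟨rfl, rfl⟩
      have := h2 0 N hN (by
        rw [Function.iterate_add_apply, ← Function.iterate_add_apply, add_comm,
          Function.iterate_add_apply] at h1
        simp only [Function.iterate_one] at h1
        rw [← Function.iterate_succ_apply, Function.iterate_succ_apply'] at h1
        have h0 : ((fun z : K => z ^ d + c)^[N] 0) ^ d = 0 := by
          have := add_right_cancel h1
          rw [this, zero_pow (by omega)]
        simpa using eq_zero_of_pow_eq_zero h0)
      omega
    · rintro ⟨rfl, rfl, rfl, rfl⟩
      have k := h3 1 (by norm_num)
      simp [Function.iterate_succ] at h1 k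
      grind
    · rintro ⟨rfl, rfl, rfl, rfl⟩
      have k0 := h2 0 2 (by norm_num)
      have k := h3 1 (by norm_num)
      simp [Function.iterate_succ] at h1 k k0
      grind
    · rintro ⟨h, hM, hN2, hd2⟩
      exact aux 1 (by norm_num) hM hN2 hd2 h
    · rintro ⟨h, hM, hN2, hd2⟩
      exact aux (-1) (by norm_num) hM hN2 hd2 h
  · rintro ⟨h1, h2, h3, h4, h5⟩
    obtain ⟨ζ, hζ⟩ : ∃ ζ : K, IsPrimitiveRoot ζ d := by
      have : NeZero (d : K) := ⟨by exact_mod_cast (by omega : d ≠ 0)⟩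
      exact HasEnoughRootsOfUnity.exists_primitiveRoot K d
    have hζ1 : ζ ≠ 1 := hζ.ne_one (by omega)
    have hζd : ζ ^ d = 1 := hζ.pow_eq_one
    have hφ : ∀ c w : K, (fun z => z ^ d + c) (ζ * w) = (fun z => z ^ d + c) w := by
      intro c w; simp [mul_pow, hζd]
    have hφn : ∀ (c w : K) (n : ℕ), 0 < n →
        (fun z => z ^ d + c)^[n] (ζ * w) = (fun z => z ^ d + c)^[n] w := by
      intro c w n hn
      obtain ⟨j, rfl⟩ : ∃ j, n = j + 1 := ⟨n - 1, by omega⟩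
      rw [Function.iterate_succ_apply, Function.iterate_succ_apply]
      exact congrArg ((fun z => z ^ d + c)^[j]) (hφ c w)
    rcases M with _ | _ | m
    · obtain ⟨c, hc, hc'⟩ := exists_per x N d hN hd (fun h => h2 ⟨h.1, rfl, h.2.1, h.2.2⟩)
      exact ⟨c, portrait_zero _ _ _ hN hc hc'⟩
    · have hx : x ≠ 0 := fun h => h1 ⟨h, rfl⟩
      obtain ⟨c, hc, hc'⟩ := exists_per (ζ * x) N d hN hd (by
        rintro ⟨ha, hb, rfl⟩
        have hm : ζ = -1 := hζ.eq_neg_one_of_two_right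
        rw [hm] at ha
        exact h3 ⟨by linear_combination -ha, rfl, hb, rfl⟩)
      refine ⟨c, portrait_succ _ x (ζ * x) 0 N hN (hφ c x) ?_ hc hc'⟩
      intro h
      exact hζ1 (mul_right_cancel₀ hx (by simpa using h))
    · by_cases hdN : 3 ≤ d ∨ 3 ≤ N
      · obtain ⟨c, ha, hb, hc⟩ := exists_gen x ζ m N d hN hd hdN hζ1
        refine ⟨c, portrait_succ _ x (ζ * (fun z => z ^ d + c)^[m + 1] x) (m + 1) N hN
          (hφ _ _) ?_ ?_ ?_⟩
        · intro h
          exact hζ1 (mul_right_cancel₀ hb (by simpa using h))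
        · rw [hφn _ _ _ hN, ← Function.iterate_add_apply, add_comm, ha]
        · intro n hn hnN hdvd
          rw [hφn _ _ _ hn, ← Function.iterate_add_apply, add_comm n]
          exact hc n hn hnN hdvd
      · obtain rfl : d = 2 := by omega
        have hN12 : N = 1 ∨ N = 2 := by omega
        rcases hN12 with rfl | rfl
        · obtain ⟨t, ht, he⟩ := exists_two_one x m
          refine ⟨t - t ^ 2, portrait_succ _ x t (m + 1) 1 hN ?_ ?_ ?_ ?_⟩
          · rw [he]; simp
          · rw [he]; intro h; exact ht (self_eq_neg.1 h)
          · simp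
          · intro n _ _; omega
        · obtain ⟨t, ht, ht', he⟩ := exists_two_two x m (by
            rintro ⟨rfl, h | h⟩
            · exact h4 ⟨h, rfl, rfl, rfl⟩
            · exact h5 ⟨h, rfl, rfl, rfl⟩)
          refine ⟨-(t ^ 2 + t + 1), portrait_succ _ x t (m + 1) 2 hN ?_ ?_ ?_ ?_⟩
          · rw [he]; simp
          · rw [he]; intro h; exact ht (self_eq_neg.1 h)
          · simp [Function.iterate_succ]; ring
          · intro n hn hn2 _
            obtain rfl : n = 1 := by omega
            simp only [Function.iterate_one]
            intro h
            apply ht'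
            linear_combination (-1/2) * h
end

section
/- Let K be an algebraically closed field of characteristic zero, let φ ∈ K[z] be a polynomial of degree d ≥ 2, and let N ≥ 1 be an integer. If φ is not linearly conjugate to z² - 3/4, then there exists x ∈ K of exact period N under φ. If φ is linearly conjugate to z² - 3/4, then there exists a point of exact period N under φ if and only if N ≠ 2. -/
open Function Polynomial

/-- `x` is periodic of exact period `N ≥ 1` under `φ`: `φ^[N] x = x` and `N` is minimal. -/
def ExactPeriod {K : Type*} (φ : K → K) (x : K) (N : ℕ) : Prop :=
  0 < N ∧ φ^[N] x = x ∧ ∀ n : ℕ, 0 < n → φ^[n] x = x → N ≤ n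

/-- `φ` and `ψ` are linearly conjugate: there is a linear `ℓ(z) = a z + b` (with `a ≠ 0`)
such that `ψ = ℓ⁻¹ ∘ φ ∘ ℓ`, i.e. `ℓ ∘ ψ = φ ∘ ℓ` as functions. -/
def LinConj {K : Type*} [Field K] (φ ψ : Polynomial K) : Prop :=
  ∃ a b : K, a ≠ 0 ∧ ∀ z : K, a * ψ.eval z + b = φ.eval (a * z + b)

open UniqueFactorizationMonoid Classical in
lemma bk_radical_deg {K : Type*} [Field K] [IsAlgClosed K] [CharZero K]
    (a S : K[X]) (ha : a ≠ 0) (hS : S ≠ 0) (h : ∀ x, a.eval x = 0 → S.eval x = 0) :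
    (radical a).natDegree ≤ S.natDegree := by
  have hsq : Squarefree (radical a) := squarefree_radical
  have hsep : (radical a).Separable := PerfectField.separable_iff_squarefree.mpr hsq
  have hnd : (radical a).roots.Nodup := nodup_roots hsep
  have hle : (radical a).roots ≤ S.roots := by
    rw [Multiset.le_iff_subset hnd]
    intro x hx
    rw [mem_roots hS]
    apply h
    have h1 := (mem_roots'.mp hx).2
    obtain ⟨t, ht⟩ := radical_dvd_self (a := a)
    rw [ht, eval_mul, h1, zero_mul]
  have h2 := Multiset.card_le_card hle
  have h3 : (radical a).natDegree = Multiset.card (radical a).roots :=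
    (IsAlgClosed.splits (radical a)).natDegree_eq_card_roots
  rw [h3]
  exact h2.trans (card_roots' S)

open UniqueFactorizationMonoid Classical in
lemma bk_key {K : Type*} [Field K] [IsAlgClosed K] [CharZero K]
    (p : K[X]) (hp : 2 ≤ p.natDegree) : ∃ A R : K[X], R = radical (p - X) ∧
      A.natDegree + 1 = R.natDegree ∧ A ≠ 0 ∧
      (∀ c Q, Q ∣ p - C c → Q ∣ derivative p → Q ∣ A * (X - C c) - R) ∧
      ∀ c, (A * (X - C c) - R).natDegree = R.natDegree ∧ A * (X - C c) - R ≠ 0 := by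
  classical
  have hXd : (X : K[X]).natDegree < p.natDegree := by rw [natDegree_X]; omega
  have hda : (p - X).natDegree = p.natDegree := natDegree_sub_eq_left_of_natDegree_lt hXd
  have hane : p - X ≠ 0 := by
    intro h; rw [h, natDegree_zero] at hda; omega
  have hD := divRadical_dvd_derivative (p - X)
  have hRD := EuclideanDomain.radical_mul_divRadical (a := p - X)
  set D := EuclideanDomain.divRadical (p - X) with hDdef
  set R := radical (p - X) with hRdef
  have hder : derivative (p - X) = derivative p - 1 := by simp
  rw [hder] at hD
  obtain ⟨A, hA⟩ := hD
  have hD0 : D ≠ 0 := by rintro h; rw [h, mul_zero] at hRD; exact hane hRD.symm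
  have hR0 : R ≠ 0 := by rintro h; rw [h, zero_mul] at hRD; exact hane hRD.symm
  have hdp : (derivative p).natDegree = p.natDegree - 1 := natDegree_derivative p
  have hdp1 : (derivative p - 1).natDegree = p.natDegree - 1 := by
    rw [← hdp]; apply natDegree_sub_eq_left_of_natDegree_lt
    rw [natDegree_one]; omega
  have hA0 : A ≠ 0 := by
    rintro h; rw [h, mul_zero] at hA; rw [hA, natDegree_zero] at hdp1; omega
  have e1 : D.natDegree + A.natDegree = p.natDegree - 1 := by
    rw [← natDegree_mul hD0 hA0, ← hA, hdp1]
  have e2 : R.natDegree + D.natDegree = p.natDegree := by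
    rw [← natDegree_mul hR0 hD0, hRD, hda]
  have hW : ∀ c, D * (A * (X - C c) - R) = derivative p * (X - C c) - (p - C c) := by
    intro c
    have : D * (A * (X - C c) - R) = (D * A) * (X - C c) - R * D := by ring
    rw [this, ← hA, hRD]; ring
  refine ⟨A, R, rfl, by omega, hA0, ?_, ?_⟩
  · intro c Q h1 h2
    have hcop : IsCoprime Q D := by
      obtain ⟨u, hu⟩ := h2
      exact ⟨u, -A, by linear_combination (-hu) + hA⟩
    refine hcop.dvd_of_dvd_mul_left ?_
    rw [hW]
    exact dvd_sub (h2.mul_right _) h1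
  · intro c
    obtain ⟨k, hk⟩ : ∃ k, p.natDegree = k + 1 := ⟨p.natDegree - 1, by omega⟩
    have hk1 : 1 ≤ k := by omega
    have hco : (D * (A * (X - C c) - R)).coeff p.natDegree ≠ 0 := by
      have hz : p.coeff (k + 1 + 1) = 0 := coeff_eq_zero_of_natDegree_lt (by omega)
      have hl : p.coeff (k + 1) ≠ 0 := by
        rw [← hk]; intro h
        have : p = 0 := leadingCoeff_eq_zero.mp h
        rw [this, natDegree_zero] at hp; omega
      rw [hW, hk, mul_sub, coeff_sub, coeff_sub, coeff_sub, coeff_mul_X, coeff_mul_C,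
        coeff_derivative, coeff_derivative, hz, coeff_C_succ]
      have : p.coeff (k + 1) * ((k:K) + 1) - 0 * (((k + 1 : ℕ) : K) + 1) * c - (p.coeff (k + 1) - 0)
        = p.coeff (k + 1) * k := by ring
      rw [this]
      exact mul_ne_zero hl (Nat.cast_ne_zero.mpr (by omega))
    have hne : D * (A * (X - C c) - R) ≠ 0 := by
      rintro h; rw [h, coeff_zero] at hco; exact hco rfl
    have hV0 := right_ne_zero_of_mul hne
    refine ⟨?_, hV0⟩
    have h1 : p.natDegree ≤ (D * (A * (X - C c) - R)).natDegree := le_natDegree_of_ne_zero hco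
    rw [natDegree_mul hD0 hV0] at h1
    have h2 : (A * (X - C c) - R).natDegree ≤ R.natDegree := by
      refine (natDegree_sub_le _ _).trans (max_le ?_ le_rfl)
      refine natDegree_mul_le.trans ?_
      rw [natDegree_X_sub_C]; omega
    omega

lemma bk_deg {K : Type*} [Field K] (f : K[X]) (n : ℕ) :
    (f.comp^[n] X).natDegree = f.natDegree ^ n := by
  rw [natDegree_iterate_comp, natDegree_X, mul_one]

open UniqueFactorizationMonoid Classical in
lemma bk_rad_bound {K : Type*} [Field K] [IsAlgClosed K] [CharZero K]
    (f : K[X]) (hd : 2 ≤ f.natDegree) (N k : ℕ) (hN : 1 ≤ N) (hk : N / 2 ≤ k)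
    (hno : ¬ ∃ x : K, ExactPeriod (fun z => f.eval z) x N) :
    (radical (f.comp^[N] X - X)).natDegree ≤ ∑ m ∈ Finset.Icc 1 k, f.natDegree ^ m := by
  have hdeg : ∀ m, 1 ≤ m → (f.comp^[m] X - X).natDegree = f.natDegree ^ m := by
    intro m hm
    rw [← bk_deg f m]
    apply natDegree_sub_eq_left_of_natDegree_lt
    rw [natDegree_X, bk_deg]
    exact Nat.one_lt_pow (by omega) (by omega)
  have hne : ∀ m, 1 ≤ m → f.comp^[m] X - X ≠ 0 := by
    intro m hm h
    have h1 := hdeg m hm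
    rw [h, natDegree_zero] at h1
    have : 0 < f.natDegree ^ m := Nat.pow_pos (by omega)
    omega
  have hS : ∏ m ∈ Finset.Icc 1 k, (f.comp^[m] X - X) ≠ 0 := by
    rw [Finset.prod_ne_zero_iff]
    intro m hm; exact hne m (Finset.mem_Icc.mp hm).1
  have := bk_radical_deg (f.comp^[N] X - X) (∏ m ∈ Finset.Icc 1 k, (f.comp^[m] X - X))
    (hne N hN) hS ?_
  · refine this.trans ?_
    refine (natDegree_prod_le _ _).trans ?_
    apply Finset.sum_le_sum
    intro m hm
    exact (hdeg m (Finset.mem_Icc.mp hm).1).le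
  · intro x hx
    rw [eval_sub, iterate_comp_eval, eval_X, sub_eq_zero] at hx
    have hper : IsPeriodicPt (fun z => f.eval z) N x := hx
    have hdvd := hper.minimalPeriod_dvd
    have hpos := hper.minimalPeriod_pos (by omega)
    set m := minimalPeriod (fun z => f.eval z) x with hm
    have hmN : m ≠ N := by
      intro h
      apply hno
      refine ⟨x, by omega, hx, ?_⟩
      intro n hn hnx
      rw [← h]
      exact IsPeriodicPt.minimalPeriod_le hn hnx
    have hmk : m ≤ N / 2 := by
      obtain ⟨t, ht⟩ := hdvd
      have : 2 ≤ t := by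
        rcases t with _ | _ | t
        · omega
        · omega
        · omega
      rw [Nat.le_div_iff_mul_le (by norm_num), ht]
      exact Nat.mul_le_mul_left _ this
    rw [eval_prod]
    apply Finset.prod_eq_zero (i := m) (Finset.mem_Icc.mpr ⟨hpos, hmk.trans hk⟩)
    rw [eval_sub, iterate_comp_eval, eval_X, sub_eq_zero]
    exact iterate_minimalPeriod

lemma bk_dvd {K : Type*} [Field K] (f q : K[X]) (n : ℕ) (c : K)
    (h1 : q ∣ f - C c) (h2 : q ∣ derivative f) :
    q.comp (f.comp^[n] X) ∣ f.comp^[n+1] X - C c ∧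
    q.comp (f.comp^[n] X) ∣ derivative (f.comp^[n+1] X) := by
  rw [iterate_succ_apply']
  constructor
  · obtain ⟨u, hu⟩ := h1
    refine ⟨u.comp (f.comp^[n] X), ?_⟩
    rw [← mul_comp, ← hu, sub_comp, C_comp]
  · obtain ⟨u, hu⟩ := h2
    rw [derivative_comp, hu, mul_comp]
    exact (dvd_mul_right _ _).mul_left _

lemma bk_crit {K : Type*} [Field K] (f : K[X]) (γ : K) : X - C γ ∣ f - C (f.eval γ) := by
  rw [dvd_iff_isRoot]; simp

lemma bk_crit2 {K : Type*} [Field K] (f : K[X]) (γ : K) (h : X - C γ ∣ derivative f) :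
    (X - C γ) ^ 2 ∣ f - C (f.eval γ) := by
  obtain ⟨u, hu⟩ := bk_crit f γ
  have hd : derivative f = u + (X - C γ) * derivative u := by
    have := congrArg derivative hu
    rw [derivative_mul] at this
    simpa using this
  rw [hd] at h
  have : X - C γ ∣ u := (dvd_add_left (dvd_mul_right _ _)).mp h
  rw [hu, sq]
  exact mul_dvd_mul_left _ this

lemma bk_geom (d k : ℕ) (hd : 2 ≤ d) : ∑ m ∈ Finset.Icc 1 k, d ^ m < d ^ (k + 1) := by
  induction k with
  | zero => simp; omega
  | succ k ih =>
    rw [Finset.sum_Icc_succ_top (by omega), pow_succ d (k+1)]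
    nlinarith [Nat.pow_pos (n := k+1) (show 0 < d by omega)]

lemma bk_critexists {K : Type*} [Field K] [IsAlgClosed K] [CharZero K]
    (f : K[X]) (hd : 2 ≤ f.natDegree) : ∃ γ : K, X - C γ ∣ derivative f := by
  have : (derivative f).degree ≠ 0 := by
    intro h
    have : (derivative f).natDegree = 0 := natDegree_eq_of_degree_eq_some h
    rw [natDegree_derivative] at this
    omega
  obtain ⟨γ, hγ⟩ := IsAlgClosed.exists_root _ this
  exact ⟨γ, dvd_iff_isRoot.mpr hγ⟩

lemma bk_ge3 {K : Type*} [Field K] [IsAlgClosed K] [CharZero K]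
    (f : K[X]) (hd : 2 ≤ f.natDegree) (N : ℕ) (hN : 3 ≤ N) :
    ∃ x : K, ExactPeriod (fun z => f.eval z) x N := by
  by_contra hno
  obtain ⟨n, rfl⟩ : ∃ n, N = n + 3 := ⟨N - 3, by omega⟩
  have hb := bk_rad_bound f hd (n + 3) (n + 1) (by omega) (by omega) hno
  have hpd : 2 ≤ (f.comp^[n+3] X).natDegree := by
    rw [bk_deg]; exact Nat.one_lt_pow (by omega) (by omega)
  obtain ⟨A, R, hR, hAR, hA0, hQ, hV⟩ := bk_key _ hpd
  obtain ⟨γ, hγ⟩ := bk_critexists f hd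
  obtain ⟨h1, h2⟩ := bk_dvd f (X - C γ) (n + 2) _ (bk_crit f γ) hγ
  have h3 := natDegree_le_of_dvd (hQ _ _ h1 h2) (hV _).2
  rw [(hV _).1, natDegree_comp, natDegree_X_sub_C, one_mul, bk_deg, hR] at h3
  exact absurd (h3.trans hb) (not_le.mpr (bk_geom f.natDegree (n + 1) hd))

lemma bk_two {K : Type*} [Field K] [IsAlgClosed K] [CharZero K]
    (f : K[X]) (hd : 3 ≤ f.natDegree) :
    ∃ x : K, ExactPeriod (fun z => f.eval z) x 2 := by
  by_contra hno
  have hb := bk_rad_bound f (by omega) 2 1 (by omega) (by omega) hno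
  simp only [Finset.Icc_self, Finset.sum_singleton, pow_one] at hb
  have hpd : 2 ≤ (f.comp^[2] X).natDegree := by
    rw [bk_deg]; exact Nat.one_lt_pow (by omega) (by omega)
  obtain ⟨A, R, hR, hAR, hA0, hQ, hV⟩ := bk_key _ hpd
  rw [← hR] at hb
  have hX : f.comp^[1] X = f := by simp
  -- general divisor
  have hq : ∀ (q : K[X]) (c : K), q ∣ f - C c → q ∣ derivative f →
      q.comp f ∣ A * (X - C c) - R := by
    intro q c h1 h2
    obtain ⟨h3, h4⟩ := bk_dvd f q 1 c h1 h2
    rw [hX] at h3 h4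
    exact hQ _ _ h3 h4
  have hbig : ∀ (q : K[X]) (c : K), q ∣ f - C c → q ∣ derivative f → q.natDegree ≤ 1 := by
    intro q c h1 h2
    have h3 := natDegree_le_of_dvd (hq q c h1 h2) (hV _).2
    rw [(hV _).1, natDegree_comp] at h3
    by_contra h
    have : 2 * f.natDegree ≤ q.natDegree * f.natDegree := Nat.mul_le_mul_right _ (by omega)
    omega
  obtain ⟨γ, hγ⟩ := bk_critexists f (by omega)
  have hγ' := hγ
  obtain ⟨g, hg⟩ := hγ'
  have hgd : g.degree ≠ 0 := by
    intro h
    have h1 : g.natDegree = 0 := natDegree_eq_of_degree_eq_some h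
    have h2 : (derivative f).natDegree = f.natDegree - 1 := natDegree_derivative f
    have h3 : (derivative f).natDegree ≤ 1 := by
      rw [hg]; refine natDegree_mul_le.trans ?_
      rw [natDegree_X_sub_C, h1]
    omega
  obtain ⟨δ, hδ⟩ := IsAlgClosed.exists_root _ hgd
  rw [← dvd_iff_isRoot] at hδ
  have hprod : (X - C γ) * (X - C δ) ∣ derivative f := by
    rw [hg]; exact mul_dvd_mul_left _ hδ
  have hdegprod : ((X - C γ) * (X - C δ)).natDegree = 2 := by
    rw [natDegree_mul (X_sub_C_ne_zero _) (X_sub_C_ne_zero _), natDegree_X_sub_C,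
      natDegree_X_sub_C]
  have hδd : X - C δ ∣ derivative f := (Dvd.intro_left _ rfl).trans hprod
  by_cases hγδ : γ = δ
  · subst hγδ
    have h1 := bk_crit2 f γ hγ
    rw [sq] at h1
    have := hbig _ _ h1 hprod
    omega
  · have hcop : IsCoprime (X - C γ) (X - C δ) := isCoprime_X_sub_C_of_isUnit_sub
      (IsUnit.mk0 _ (sub_ne_zero.mpr hγδ))
    by_cases hc : f.eval γ = f.eval δ
    · have h1 : (X - C γ) * (X - C δ) ∣ f - C (f.eval γ) :=
        hcop.mul_dvd (bk_crit f γ) (by rw [hc]; exact bk_crit f δ)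
      have := hbig _ _ h1 hprod
      omega
    · obtain ⟨u, hu⟩ := hq _ _ (bk_crit f γ) hγ
      obtain ⟨v, hv⟩ := hq _ _ (bk_crit f δ) hδd
      have hconst : ∀ (β : K) (w : K[X]) (c : K), A * (X - C c) - R = (X - C β).comp f * w →
          ∃ k : K, w = C k ∧ R.natDegree = f.natDegree := by
        intro β w c h
        have h0 := (hV c).2
        have h1 := (hV c).1
        rw [h] at h0 h1
        rw [natDegree_mul (left_ne_zero_of_mul h0) (right_ne_zero_of_mul h0), natDegree_comp,
          natDegree_X_sub_C, one_mul] at h1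
        exact ⟨w.coeff 0, eq_C_of_natDegree_eq_zero (by omega), by omega⟩
      obtain ⟨k, rfl, hRd⟩ := hconst _ _ _ hu
      obtain ⟨l, rfl, -⟩ := hconst _ _ _ hv
      simp only [sub_comp, X_comp, C_comp] at hu hv
      have hdiff : A * C (f.eval δ - f.eval γ) = f * C (k - l) + C (δ * l - γ * k) := by
        simp only [C_sub, C_mul]
        linear_combination hu - hv
      have hne : f.eval δ - f.eval γ ≠ 0 := sub_ne_zero.mpr (Ne.symm hc)
      have hAd : (A * C (f.eval δ - f.eval γ)).natDegree = A.natDegree :=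
        natDegree_mul_C hne
      by_cases hkl : k - l = 0
      · rw [hdiff, hkl, C_0, mul_zero, zero_add, natDegree_C] at hAd
        omega
      · rw [hdiff, natDegree_add_C, natDegree_mul_C hkl] at hAd
        omega

lemma bk_one {K : Type*} [Field K] [IsAlgClosed K] 
    (f : K[X]) (hd : 2 ≤ f.natDegree) :
    ∃ x : K, ExactPeriod (fun z => f.eval z) x 1 := by
  have hdeg : (f - X).natDegree = f.natDegree :=
    natDegree_sub_eq_left_of_natDegree_lt (by rw [natDegree_X]; omega)
  have : (f - X).degree ≠ 0 := by
    intro h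
    have : (f - X).natDegree = 0 := natDegree_eq_of_degree_eq_some h
    omega
  obtain ⟨x, hx⟩ := IsAlgClosed.exists_root _ this
  refine ⟨x, by norm_num, ?_, fun n hn _ => hn⟩
  rw [IsRoot, eval_sub, eval_X, sub_eq_zero] at hx
  simpa using hx

lemma bk_quad {K : Type*} [Field K] [IsAlgClosed K] [CharZero K]
    (f : K[X]) (hd : f.natDegree = 2) (hnc : ¬ LinConj f (X ^ 2 - C (3 / 4 : K))) :
    ∃ x : K, ExactPeriod (fun z => f.eval z) x 2 := by
  obtain ⟨a, b, e, ha, rfl⟩ : ∃ a b e : K, a ≠ 0 ∧ f = C a * X ^ 2 + C b * X + C e := by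
    refine ⟨f.coeff 2, f.coeff 1, f.coeff 0, ?_, ?_⟩
    · rw [← hd]; intro h
      have : f = 0 := leadingCoeff_eq_zero.mp h
      rw [this, natDegree_zero] at hd; omega
    · conv_lhs => rw [f.as_sum_range_C_mul_X_pow, hd]
      simp [Finset.sum_range_succ]; ring
  have hdeg : (C (a^2) * X ^ 2 + C (a * b + a) * X + C (a * e + b + 1) : K[X]).degree ≠ 0 := by
    rw [degree_quadratic (pow_ne_zero 2 ha)]; norm_num
  obtain ⟨x, hx⟩ := IsAlgClosed.exists_root _ hdeg
  simp only [IsRoot, eval_add, eval_mul, eval_C, eval_pow, eval_X] at hx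
  have hfx : ∀ z, (C a * X ^ 2 + C b * X + C e : K[X]).eval z = a * z ^ 2 + b * z + e := by
    intro z; simp
  simp only [LinConj, hfx] at hnc
  have h2 : (2 : K) ≠ 0 := two_ne_zero
  have h4 : (4 : K) ≠ 0 := by norm_num
  have hnf : a * x ^ 2 + b * x + e ≠ x := by
    intro h
    apply hnc
    refine ⟨1 / a, - b / (2 * a), by simp [ha], ?_⟩
    intro z
    simp only [eval_sub, eval_pow, eval_X, eval_C]
    have h5 : 2 * a * x + b + 1 = 0 := by linear_combination hx - a * h
    have hxe : x = -(b + 1) / (2 * a) := by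
      field_simp; linear_combination h5
    have he : e = (b ^ 2 - 2 * b - 3) / (4 * a) := by
      have : e = x - a * x ^ 2 - b * x := by linear_combination h
      rw [this, hxe]; field_simp; ring
    rw [he]; field_simp; ring
  refine ⟨x, by norm_num, ?_, ?_⟩
  · simp only [iterate_succ, iterate_zero, comp_apply, id, hfx]
    linear_combination (a * x ^ 2 + b * x + e - x) * hx
  · intro n hn hnx
    by_contra h
    obtain rfl : n = 1 := by omega
    simp only [iterate_one, hfx] at hnx
    exact hnf hnx

lemma bk_conj {K : Type*} [Field K] [CharZero K]
    (f : K[X]) (hc : LinConj f (X ^ 2 - C (3 / 4 : K))) :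
    ¬ ∃ x : K, ExactPeriod (fun z => f.eval z) x 2 := by
  rintro ⟨x, -, hx, hmin⟩
  obtain ⟨a, b, ha, h⟩ := hc
  simp only [eval_sub, eval_pow, eval_X, eval_C] at h
  obtain ⟨w, rfl⟩ : ∃ w, x = a * w + b := ⟨(x - b) / a, by field_simp; ring⟩
  simp only [iterate_succ, iterate_zero, comp_apply, id, ← h] at hx
  have h1 : (w ^ 2 - 3 / 4) ^ 2 - 3 / 4 = w := by
    apply mul_left_cancel₀ ha; linear_combination hx
  have h2 : (w ^ 2 - 3 / 4 - w) * (w + 1 / 2) ^ 2 = 0 := by linear_combination h1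
  have h3 : w ^ 2 - 3 / 4 = w := by
    rcases mul_eq_zero.mp h2 with h | h
    · linear_combination h
    · have : w + 1 / 2 = 0 := by simpa using h
      linear_combination (w - 3 / 2) * this
  have := hmin 1 one_pos (by simp only [iterate_one, ← h, h3])
  omega

/-- Baker's theorem: a polynomial `φ` of degree `d ≥ 2` admits a point of exact period `N`
for every `N ≥ 1`, unless `φ` is linearly conjugate to `z² - 3/4`, in which case it admits a
point of exact period `N` iff `N ≠ 2`. -/
theorem baker_periodic_points (K : Type*) [Field K] [IsAlgClosed K] [CharZero K]
    (φ : Polynomial K) (hdeg : 2 ≤ φ.natDegree) (N : ℕ) (hN : 1 ≤ N) :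
    (¬ LinConj φ (X ^ 2 - C (3 / 4 : K)) →
      ∃ x : K, ExactPeriod (fun z => φ.eval z) x N) ∧
    (LinConj φ (X ^ 2 - C (3 / 4 : K)) →
      ((∃ x : K, ExactPeriod (fun z => φ.eval z) x N) ↔ N ≠ 2)) := by
  have hne2 : N ≠ 2 → ∃ x : K, ExactPeriod (fun z => φ.eval z) x N := by
    intro h
    by_cases h1 : N = 1
    · subst h1; exact bk_one φ hdeg
    · exact bk_ge3 φ hdeg N (by omega)
  refine ⟨?_, ?_⟩
  · intro hnc
    by_cases h : N = 2
    · subst h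
      by_cases hd : φ.natDegree = 2
      · exact bk_quad φ hd hnc
      · exact bk_two φ (by omega)
    · exact hne2 h
  · intro hc
    refine ⟨?_, hne2⟩
    rintro hx rfl
    exact bk_conj φ hc hx
end

section
/- Let K be an algebraically closed field of characteristic zero. For every x ∈ K and all integers M ≥ 0, N ≥ 1, and d ≥ 2, there exists a polynomial φ ∈ K[z] of degree d such that x has portrait (M,N) under φ. -/
open Function Polynomial

theorem exists_poly_with_portrait (K : Type*) [Field K] [IsAlgClosed K] [CharZero K]
    (x : K) (M N d : ℕ) (hN : 1 ≤ N) (hd : 2 ≤ d) :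
    ∃ φ : Polynomial K, φ.natDegree = d ∧ Portrait (fun z => φ.eval z) x M N := by
  have hpos : ∀ n, 0 < n → 0 < d ^ n - 1 := by
    intro n hn
    have : 1 < d ^ n := Nat.one_lt_pow (by omega) (by omega)
    omega
  have hk : d ^ M * (d ^ N - 1) ≠ 0 :=
    Nat.mul_ne_zero (pow_ne_zero _ (by omega)) (hpos N hN).ne'
  have : NeZero (d ^ M * (d ^ N - 1)) := ⟨hk⟩
  have : NeZero ((d ^ M * (d ^ N - 1) : ℕ) : K) := ⟨Nat.cast_ne_zero.mpr hk⟩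
  obtain ⟨ζ, hζ⟩ := HasEnoughRootsOfUnity.exists_primitiveRoot K (d ^ M * (d ^ N - 1))
  have hζ0 : ζ ≠ 0 := hζ.ne_zero hk
  have key : ∀ m n : ℕ, ζ ^ d ^ (m + n) = ζ ^ d ^ m ↔
      d ^ M * (d ^ N - 1) ∣ d ^ m * (d ^ n - 1) := by
    intro m n
    rw [← hζ.pow_eq_one_iff_dvd]
    have h1 : d ^ (m + n) = d ^ m * (d ^ n - 1) + d ^ m := by
      have : 1 ≤ d ^ n := Nat.one_le_pow _ _ (by omega)
      obtain ⟨c, hc⟩ := Nat.exists_eq_add_of_le this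
      rw [pow_add, hc, Nat.add_sub_cancel_left]; ring
    rw [h1, pow_add]
    exact mul_eq_right₀ (pow_ne_zero _ hζ0)
  refine ⟨(X + C (ζ - x)) ^ d + C (x - ζ), ?_, ?_⟩
  · rw [natDegree_add_C, natDegree_pow, natDegree_X_add_C, mul_one]
  have it : ∀ k, (fun z => ((X + C (ζ - x)) ^ d + C (x - ζ) : K[X]).eval z)^[k] x
      = ζ ^ d ^ k + (x - ζ) := by
    intro k
    induction k with
    | zero => simp
    | succ k ih =>
      rw [Function.iterate_succ_apply', ih]
      simp only [eval_add, eval_pow, eval_X, eval_C]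
      rw [pow_succ d, pow_mul]
      congr 2
      ring
  unfold Portrait
  simp only [it, add_left_inj, key]
  refine ⟨hN, dvd_rfl, ?_, ?_⟩
  · intro m n hn h
    have hc : Nat.Coprime (d ^ M) (d ^ n - 1) := by
      apply Nat.Coprime.pow_left
      have h2 : Nat.Coprime (d ^ n) (d ^ n - 1) := by
        rw [Nat.coprime_self_sub_right (Nat.one_le_pow _ _ (by omega))]
        exact Nat.coprime_one_right _
      exact (Nat.coprime_pow_left_iff hn _ _).1 h2
    have h3 := hc.dvd_of_dvd_mul_right ((Dvd.intro _ rfl).trans h)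
    exact (Nat.pow_dvd_pow_iff_le_right (by omega)).1 h3
  · intro n hn h
    have h4 := Nat.le_of_dvd (hpos n hn)
      (Nat.dvd_of_mul_dvd_mul_left (pow_pos (by omega) M) h)
    have := hpos n hn
    have := hpos N hN
    exact (Nat.pow_le_pow_iff_right (show 1 < d by omega)).1 (by omega)
end

section
/- Let K be an algebraically closed field of characteristic zero. There is no c ∈ K such that 1/2 has portrait (1,2) under f_{2,c}(z) = z² + c, i.e., no c for which 1/2 has preperiod exactly 1 and eventual period exactly 2 under f_{2,c}. -/
open Function

/-- There is no `c ∈ K` such that `1/2` has portrait `(1,2)` under `f_{2,c}(z) = z² + c`. -/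
theorem half_no_portrait_one_two (K : Type*) [Field K] [IsAlgClosed K] [CharZero K] :
    ¬ ∃ c : K, Portrait (fun z => z ^ 2 + c) ((1 / 2 : K)) 1 2 := by
  rintro ⟨c, -, h, hm, hn⟩
  have h0 := hm 0 2 (by norm_num)
  have h1 := hn 1 (by norm_num)
  simp only [Function.iterate_succ, Function.iterate_zero, Function.comp, id] at h h0 h1
  have e : (c + 3 / 4) ^ 2 * (((1 / 2 : K) ^ 2 + c) ^ 2 + c - 1 / 2) = 0 := by
    linear_combination h
  rcases mul_eq_zero.mp e with e | e
  · have hc : c = -(3 / 4) := eq_neg_of_add_eq_zero_left (pow_eq_zero_iff (two_ne_zero) |>.mp e)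
    subst hc
    have := h1 (by norm_num)
    omega
  · have := h0 (sub_eq_zero.mp e)
    omega
end

section
/- Let K be an algebraically closed field of characteristic zero and let x ∈ {1, -1} ⊆ K. There is no c ∈ K such that x has portrait (2,2) under f_{2,c}(z) = z² + c, i.e., no c for which x has preperiod exactly 2 and eventual period exactly 2 under f_{2,c}. -/
open Function

/-- There is no `c ∈ K` such that `x = ±1` has portrait `(2,2)` under `f_{2,c}(z) = z² + c`. -/
theorem pm_one_no_portrait_two_two (K : Type*) [Field K] [IsAlgClosed K] [CharZero K]
    (x : K) (hx : x = 1 ∨ x = -1) :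
    ¬ ∃ c : K, Portrait (fun z => z ^ 2 + c) x 2 2 := by
  rintro ⟨c, -, h, hM, hN⟩
  have hx2 : x ^ 2 = 1 := by rcases hx with rfl | rfl <;> norm_num
  have h13 : ¬ (((1 + c) ^ 2 + c) ^ 2 + c = 1 + c) := by
    intro e
    have := hM 1 2 (by norm_num) (by simpa [Function.iterate_succ_apply, hx2] using e)
    omega
  have h23 : ¬ (((1 + c) ^ 2 + c) ^ 2 + c = (1 + c) ^ 2 + c) := by
    intro e
    have := hN 1 (by norm_num) (by simpa [Function.iterate_succ_apply, hx2] using e)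
    omega
  have h4 : (((1 + c) ^ 2 + c) ^ 2 + c) ^ 2 + c = (1 + c) ^ 2 + c := by
    simpa [Function.iterate_succ_apply, hx2] using h
  have h3 : ((1 + c) ^ 2 + c) ^ 2 + c = -(1 + c) := by
    rcases sq_eq_sq_iff_eq_or_eq_neg.mp (add_right_cancel h4) with e | e
    · exact absurd e h13
    · exact e
  have h5 : (1 + c) ^ 2 = 0 := by
    have hne : (1 + c) ^ 2 + c + (1 + c) ≠ 0 := by
      intro e
      apply h23
      rw [h3]
      linear_combination -e
    apply (mul_eq_zero.mp _).resolve_left hne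
    linear_combination h3
  have h6 : 1 + c = 0 := by simpa using h5
  apply h13
  rw [h3, h6, neg_zero]
end

section
/- Fix an integer d ≥ 2 and for N ≥ 1 define D(N) := Σ_{n ∣ N} μ(N/n)·d^n, where μ is the Möbius function. If (N,d) ≠ (2,2), then D(N) > Σ_{n ∣ N, n < N} D(n); if (N,d) = (2,2), then D(N) = Σ_{n ∣ N, n < N} D(n). -/
open Finset

/-- `D(N) = ∑_{n ∣ N} μ(N/n) d^n`, the degree in `X` of the `N`-th dynatomic polynomial. -/
def dynDeg (d N : ℕ) : ℤ :=
  ∑ n ∈ N.divisors, (ArithmeticFunction.moebius (N / n)) * (d : ℤ) ^ n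

theorem sum_div_split (f : ℕ → ℤ) (N : ℕ) (hN : 1 ≤ N) :
    ∑ i ∈ N.divisors, f i = ∑ i ∈ N.properDivisors, f i + f N := by
  rw [← Nat.insert_self_properDivisors (by omega), sum_insert Nat.self_notMem_properDivisors, add_comm]

theorem dynDeg_sum (d n : ℕ) (hn : 0 < n) : ∑ i ∈ n.divisors, dynDeg d i = (d : ℤ) ^ n := by
  refine (ArithmeticFunction.sum_eq_iff_sum_mul_moebius_eq (R := ℤ) (f := dynDeg d)
    (g := fun n => (d : ℤ) ^ n)).2 ?_ n hn
  intro m hm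
  unfold dynDeg
  simp only [Int.cast_id]
  rw [Nat.sum_divisorsAntidiagonal' (f := fun a b => ArithmeticFunction.moebius a * (d : ℤ) ^ b)]

theorem geom_bd (d m : ℕ) (hd : 2 ≤ d) : ∑ i ∈ Icc 1 m, (d : ℤ) ^ i ≤ 2 * (d : ℤ) ^ m - 2 := by
  have hd' : (2 : ℤ) ≤ d := by exact_mod_cast hd
  induction m with
  | zero => simp
  | succ k ih =>
    rw [Finset.sum_Icc_succ_top (by omega)]
    have : (0 : ℤ) < (d : ℤ) ^ k := by positivity
    have h2 : 2 * (d : ℤ) ^ k ≤ (d : ℤ) ^ (k + 1) := by rw [pow_succ]; nlinarith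
    linarith

theorem dynDeg_lower (d N : ℕ) (hd : 2 ≤ d) (hN : 1 ≤ N) :
    (d : ℤ) ^ N - dynDeg d N ≤ 2 * (d : ℤ) ^ (N / 2) - 2 := by
  refine le_trans ?_ (geom_bd d (N / 2) hd)
  have h1 : ∑ i ∈ N.properDivisors, (d : ℤ) ^ i ≤ ∑ i ∈ Icc 1 (N / 2), (d : ℤ) ^ i := by
    apply Finset.sum_le_sum_of_subset_of_nonneg
    · intro i hi
      rw [Nat.mem_properDivisors] at hi
      obtain ⟨⟨k, rfl⟩, h⟩ := hi
      have hi0 : 0 < i := Nat.pos_of_ne_zero (by rintro rfl; simp at hN)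
      have hk : 2 ≤ k := by
        by_contra hc
        have : k ≤ 1 := by omega
        nlinarith
      rw [mem_Icc]
      refine ⟨hi0, ?_⟩
      rw [Nat.le_div_iff_mul_le (by norm_num)]
      nlinarith
    · intros; positivity
  refine le_trans ?_ h1
  unfold dynDeg
  rw [sum_div_split _ N hN, Nat.div_self (by omega)]
  have h2 : -∑ i ∈ N.properDivisors, (ArithmeticFunction.moebius (N / i)) * (d : ℤ) ^ i
      ≤ ∑ i ∈ N.properDivisors, (d : ℤ) ^ i := by
    rw [← Finset.sum_neg_distrib]
    apply Finset.sum_le_sum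
    intro i _
    have hp : (0 : ℤ) < (d : ℤ) ^ i := by positivity
    have := (abs_le.1 (ArithmeticFunction.abs_moebius_le_one (n := N / i))).1
    nlinarith
  simp only [ArithmeticFunction.moebius_apply_one]
  linarith

/-- If `(N,d) ≠ (2,2)` then `D(N) > ∑_{n ∣ N, n < N} D(n)`; if `(N,d) = (2,2)` then
equality holds. -/
theorem dynDeg_gt_sum_properDivisors (d N : ℕ) (hd : 2 ≤ d) (hN : 1 ≤ N) :
    (¬(N = 2 ∧ d = 2) → dynDeg d N > ∑ n ∈ N.properDivisors, dynDeg d n) ∧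
    ((N = 2 ∧ d = 2) → dynDeg d N = ∑ n ∈ N.properDivisors, dynDeg d n) := by
  have hs := dynDeg_sum d N hN
  rw [sum_div_split _ N hN] at hs
  have hd' : (2 : ℤ) ≤ d := by exact_mod_cast hd
  have e1 : dynDeg d 1 = d := by simp [dynDeg]
  have p2 : Nat.properDivisors 2 = {1} := by decide
  constructor
  · intro h
    by_cases h3 : 3 ≤ N
    · have hl := dynDeg_lower d N hd hN
      have hp : (0 : ℤ) < (d : ℤ) ^ (N / 2) := by positivity
      have h4 : (d : ℤ) ^ (N / 2 + 2) ≤ (d : ℤ) ^ N :=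
        pow_le_pow_right₀ (by linarith) (by omega)
      have h5 : 4 * (d : ℤ) ^ (N / 2) ≤ (d : ℤ) ^ (N / 2 + 2) := by
        rw [pow_add]
        have : (4 : ℤ) ≤ (d : ℤ) ^ 2 := by nlinarith
        nlinarith
      linarith
    · obtain rfl | rfl : N = 1 ∨ N = 2 := by omega
      · simp [e1]; omega
      · rw [p2, sum_singleton, e1] at hs ⊢
        have : (3 : ℤ) ≤ d := by
          have : d ≠ 2 := fun hh => h ⟨rfl, hh⟩
          omega
        nlinarith
  · rintro ⟨rfl, rfl⟩
    rw [p2, sum_singleton, e1] at hs ⊢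
    push_cast at hs ⊢
    linarith
end

section
/- Let d ≥ 2 be an integer and let x and c be elements of the algebraic closure of ℚ such that x is preperiodic under f_{d,c} (i.e., f_{d,c}^{m+n}(x) = f_{d,c}^m(x) for some integers m ≥ 0, n ≥ 1). Then x is integral over ℤ if and only if c is integral over ℤ. -/
open Function

open Polynomial in
lemma aux_final {A : Type*} [Field A] (P Q : Polynomial (integralClosure ℤ A)) (hP : P.Monic)
    (hQ : Q.degree < P.degree) (x : A) (h : aeval x P = aeval x Q) : IsIntegral ℤ x := by
  have : IsIntegral (integralClosure ℤ A) x := by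
    refine ⟨P - Q, hP.sub_of_left hQ, ?_⟩
    rw [← aeval_def, map_sub, h, sub_self]
  exact isIntegral_trans x this

open Polynomial in
lemma aux_step {R : Type*} [CommRing R] [Nontrivial R] (P Q : Polynomial R) (d : ℕ) (hP : P.Monic)
    (hQ : Q.natDegree < P.natDegree * d) :
    (P ^ d + Q).Monic ∧ (P ^ d + Q).natDegree = d * P.natDegree := by
  have h1 : (P ^ d).natDegree = d * P.natDegree := hP.natDegree_pow d
  have h2 : Q.degree < (P ^ d).degree := by
    apply degree_lt_degree
    rw [h1, mul_comm]; exact hQ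
  refine ⟨(hP.pow d).add_of_left h2, ?_⟩
  rw [natDegree_add_eq_left_of_degree_lt h2, h1]

open Polynomial in
lemma aux_main {A : Type*} [Field A] (d : ℕ) (hd : 2 ≤ d) (x c : A)
    (h : ∃ m n : ℕ, 0 < n ∧
      (fun z => z ^ d + c)^[m + n] x = (fun z => z ^ d + c)^[m] x) :
    (IsIntegral ℤ x ↔ IsIntegral ℤ c) := by
  obtain ⟨m, n, hn, h⟩ := h
  constructor
  · intro hx
    let x' : integralClosure ℤ (A) := ⟨x, hx⟩
    let P : ℕ → Polynomial (integralClosure ℤ (A)) :=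
      fun k => (fun p => p ^ d + X)^[k] (C x')
    have hs : ∀ k, P (k + 1) = P k ^ d + X := fun k => iterate_succ_apply' _ _ _
    have h0 : P 0 = C x' := rfl
    have he : ∀ k, aeval c (P k) = (fun z => z ^ d + c)^[k] x := by
      intro k
      induction k with
      | zero => rw [h0, aeval_C]; rfl
      | succ k ih => rw [hs, iterate_succ_apply', map_add, map_pow, ih, aeval_X]
    have hm : ∀ k, (P (k + 1)).Monic ∧ (P (k + 1)).natDegree = d ^ k := by
      intro k
      induction k with
      | zero =>
        rw [hs, h0, ← C_pow, add_comm]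
        exact ⟨monic_X_add_C _, by rw [natDegree_X_add_C, pow_zero]⟩
      | succ k ih =>
        have hk : 0 < d ^ k := by positivity
        have := aux_step (P (k + 1)) X d ih.1 (by rw [ih.2, natDegree_X]; nlinarith)
        rw [hs (k + 1)]
        exact ⟨this.1, by rw [this.2, ih.2, pow_succ']⟩
    obtain ⟨n, rfl⟩ : ∃ j, n = j + 1 := ⟨n - 1, by omega⟩
    refine aux_final (P (m + n + 1)) (P m) (hm _).1 ?_ c (by rw [he, he]; exact h)
    apply degree_lt_degree
    rw [(hm _).2]
    rcases m with _ | m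
    · rw [h0, natDegree_C]; positivity
    · rw [(hm _).2]; exact Nat.pow_lt_pow_right (by omega) (by omega)
  · intro hc
    let c' : integralClosure ℤ (A) := ⟨c, hc⟩
    let P : ℕ → Polynomial (integralClosure ℤ (A)) :=
      fun k => (fun p => p ^ d + C c')^[k] X
    have hs : ∀ k, P (k + 1) = P k ^ d + C c' := fun k => iterate_succ_apply' _ _ _
    have h0 : P 0 = X := rfl
    have he : ∀ k, aeval x (P k) = (fun z => z ^ d + c)^[k] x := by
      intro k
      induction k with
      | zero => rw [h0, aeval_X]; rfl
      | succ k ih => rw [hs, iterate_succ_apply', map_add, map_pow, ih, aeval_C]; rfl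
    have hm : ∀ k, (P k).Monic ∧ (P k).natDegree = d ^ k := by
      intro k
      induction k with
      | zero => rw [h0]; exact ⟨monic_X, by simp⟩
      | succ k ih =>
        have := aux_step (P k) (C c') d ih.1 (by rw [ih.2, natDegree_C]; positivity)
        rw [hs]
        exact ⟨this.1, by rw [this.2, ih.2, pow_succ']⟩
    refine aux_final (P (m + n)) (P m) (hm _).1 ?_ x (by rw [he, he]; exact h)
    apply degree_lt_degree
    rw [(hm _).2, (hm _).2]; exact Nat.pow_lt_pow_right (by omega) (by omega)

/-- If `x` is preperiodic under `f_{d,c}(z) = z^d + c` over `ℚ̄`, then `x` is an algebraic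
integer if and only if `c` is. -/
theorem integral_iff_of_preperiodic (d : ℕ) (hd : 2 ≤ d) (x c : AlgebraicClosure ℚ)
    (h : ∃ m n : ℕ, 0 < n ∧
      (fun z => z ^ d + c)^[m + n] x = (fun z => z ^ d + c)^[m] x) :
    (IsIntegral ℤ x ↔ IsIntegral ℤ c) := by
  have := aux_main d hd x c h
  convert this <;> exact Subsingleton.elim _ _
end

section
/- Let d ≥ 2 and N ≥ 1 be integers and let x and c be elements of the algebraic closure of ℚ. If x is a multiple root of the polynomial f_{d,c}^N(X) − X, i.e., (X − x)² divides f_{d,c}^N(X) − X in ℚ̄[X], then neither x nor c is integral over ℤ. -/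
open Polynomial

/-- The `N`-th iterate of `z ↦ z^d + c` applied to the variable `X`, as a polynomial. -/
noncomputable def iterPoly (d : ℕ) (c : AlgebraicClosure ℚ) : ℕ → Polynomial (AlgebraicClosure ℚ)
  | 0 => X
  | n + 1 => iterPoly d c n ^ d + C c

noncomputable def auxPoly {R : Type*} [CommRing R] (d : ℕ) (a b : R[X]) : ℕ → R[X]
  | 0 => a
  | n + 1 => auxPoly d a b n ^ d + b

theorem aux_eval {R : Type*} [CommRing R] [Algebra R (AlgebraicClosure ℚ)] (d : ℕ) (a b : R[X])
    (t x c : AlgebraicClosure ℚ) (ha : aeval t a = x) (hb : aeval t b = c) (n : ℕ) :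
    aeval t (auxPoly d a b n) = (iterPoly d c n).eval x := by
  induction n with
  | zero => simp [auxPoly, iterPoly, ha]
  | succ n ih => simp [auxPoly, iterPoly, ih, hb]

theorem aux_monic1 {R : Type*} [CommRing R] [Nontrivial R] (d : ℕ) (hd : 2 ≤ d) (c : R) (n : ℕ) :
    (auxPoly d X (C c) n).Monic ∧ (auxPoly d X (C c) n).natDegree = d ^ n := by
  induction n with
  | zero => simp [auxPoly, monic_X]
  | succ n ih =>
    obtain ⟨h1, h2⟩ := ih
    have hdeg : (auxPoly d X (C c) n ^ d).natDegree = d ^ (n+1) := by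
      rw [h1.natDegree_pow, h2]; ring
    have hpos : 0 < d ^ (n+1) := by positivity
    have hlt : (C c).natDegree < (auxPoly d X (C c) n ^ d).natDegree := by
      rw [hdeg, natDegree_C]; exact hpos
    refine ⟨(h1.pow d).add_of_left (degree_lt_degree hlt), ?_⟩
    rw [auxPoly, natDegree_add_eq_left_of_natDegree_lt hlt, hdeg]

theorem aux_monic2 {R : Type*} [CommRing R] [Nontrivial R] (d : ℕ) (hd : 2 ≤ d) (x : R) (n : ℕ) :
    (auxPoly d (C x) X (n+1)).Monic ∧ (auxPoly d (C x) X (n+1)).natDegree = d ^ n := by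
  induction n with
  | zero =>
    have : auxPoly d (C x) X (0+1) = X + C (x ^ d) := by simp [auxPoly, add_comm]
    rw [this]
    exact ⟨monic_X_add_C _, natDegree_X_add_C _⟩
  | succ n ih =>
    obtain ⟨h1, h2⟩ := ih
    have hdeg : (auxPoly d (C x) X (n+1) ^ d).natDegree = d ^ (n+1) := by
      rw [h1.natDegree_pow, h2]; ring
    have hpos : 1 < d ^ (n+1) := Nat.one_lt_pow (by omega) (by omega)
    have hlt : (X : R[X]).natDegree < (auxPoly d (C x) X (n+1) ^ d).natDegree := by
      rw [hdeg, natDegree_X]; exact hpos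
    refine ⟨(h1.pow d).add_of_left (degree_lt_degree hlt), ?_⟩
    rw [auxPoly, natDegree_add_eq_left_of_natDegree_lt hlt, hdeg]

theorem x_int (d N : ℕ) (hd : 2 ≤ d) (hN : 1 ≤ N) (x c : AlgebraicClosure ℚ)
    (h : (iterPoly d c N).eval x = x) (hc : IsIntegral ℤ c) : IsIntegral ℤ x := by
  let R := integralClosure ℤ (AlgebraicClosure ℚ)
  let c' : R := ⟨c, hc⟩
  obtain ⟨h1, h2⟩ := aux_monic1 d hd c' N
  have : IsIntegral R x := by
    refine ⟨auxPoly d X (C c') N - X, h1.sub_of_left (degree_lt_degree ?_), ?_⟩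
    · rw [h2, natDegree_X]; exact Nat.one_lt_pow (by omega) (by omega)
    · rw [← aeval_def, map_sub, aux_eval d X (C c') x x c (by simp) (by simp; rfl), h]
      simp
  exact isIntegral_trans x this

theorem c_int (d N : ℕ) (hd : 2 ≤ d) (hN : 1 ≤ N) (x c : AlgebraicClosure ℚ)
    (h : (iterPoly d c N).eval x = x) (hx : IsIntegral ℤ x) : IsIntegral ℤ c := by
  let R := integralClosure ℤ (AlgebraicClosure ℚ)
  let x' : R := ⟨x, hx⟩
  obtain ⟨n, rfl⟩ : ∃ n, N = n + 1 := ⟨N - 1, by omega⟩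
  obtain ⟨h1, h2⟩ := aux_monic2 d hd x' n
  have : IsIntegral R c := by
    refine ⟨auxPoly d (C x') X (n+1) - C x', h1.sub_of_left (degree_lt_degree ?_), ?_⟩
    · rw [h2, natDegree_C]; positivity
    · rw [← aeval_def, map_sub, aux_eval d (C x') X c x c (by simp; rfl) (by simp), h]
      simp only [aeval_C]
      exact sub_self x
  exact isIntegral_trans c this

theorem both_false (d N : ℕ) (hd : 2 ≤ d) (hN : 1 ≤ N) (x c : AlgebraicClosure ℚ)
    (h : (derivative (iterPoly d c N)).eval x = 1) (hx : IsIntegral ℤ x) (hc : IsIntegral ℤ c) :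
    False := by
  have e : ∀ n, IsIntegral ℤ ((iterPoly d c n).eval x) := by
    intro n
    induction n with
    | zero => simpa [iterPoly] using hx
    | succ n ih => simpa [iterPoly] using (ih.pow d).add hc
  have key : ∀ n, (derivative (iterPoly d c (n+1))).eval x =
      d * ((iterPoly d c n).eval x ^ (d-1) * (derivative (iterPoly d c n)).eval x) := by
    intro n
    simp [iterPoly, derivative_pow, mul_assoc]
  have dd : IsIntegral ℤ (d : AlgebraicClosure ℚ) := by
    simpa using (isIntegral_algebraMap (R := ℤ) (A := AlgebraicClosure ℚ) (x := (d : ℤ)))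
  have e' : ∀ n, IsIntegral ℤ ((derivative (iterPoly d c n)).eval x) := by
    intro n
    induction n with
    | zero => simpa [iterPoly] using isIntegral_one
    | succ n ih => rw [key]; exact dd.mul (((e n).pow _).mul ih)
  obtain ⟨n, rfl⟩ : ∃ n, N = n + 1 := ⟨N - 1, by omega⟩
  rw [key] at h
  have hy := ((e n).pow (d-1)).mul (e' n)
  rw [eq_inv_of_mul_eq_one_right h] at hy
  have hq : IsIntegral ℤ ((d : ℚ)⁻¹) := by
    rw [← isIntegral_algebraMap_iff (algebraMap ℚ (AlgebraicClosure ℚ)).injective]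
    simpa using hy
  obtain ⟨m, hm⟩ := IsIntegrallyClosed.isIntegral_iff.mp hq
  have hd0 : (d : ℚ) ≠ 0 := by positivity
  have h1 : (d : ℤ) * m = 1 := by
    have : (d : ℚ) * m = 1 := by
      have hm' : (m : ℚ) = (d : ℚ)⁻¹ := by simpa using hm
      rw [hm', mul_inv_cancel₀ hd0]
    exact_mod_cast this
  have := Int.eq_one_or_neg_one_of_mul_eq_one h1
  omega

/-- If `x` is a multiple root of `f_{d,c}^N(X) - X`, then neither `x` nor `c` is an
algebraic integer. -/
theorem not_integral_of_multiple_root (d N : ℕ) (hd : 2 ≤ d) (hN : 1 ≤ N)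
    (x c : AlgebraicClosure ℚ)
    (h : (X - C x) ^ 2 ∣ (iterPoly d c N - X)) :
    ¬ IsIntegral ℤ x ∧ ¬ IsIntegral ℤ c := by
  obtain ⟨q, hq⟩ := h
  have h0 : (iterPoly d c N).eval x = x := by
    have := congrArg (eval x) hq
    simp at this
    exact sub_eq_zero.mp this
  have h1 : (derivative (iterPoly d c N)).eval x = 1 := by
    have := congrArg (fun p => eval x (derivative p)) hq
    simp [derivative_pow] at this
    exact sub_eq_zero.mp this
  exact ⟨fun hx => both_false d N hd hN x c h1 hx (c_int d N hd hN x c h0 hx),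
    fun hc => both_false d N hd hN x c h1 (x_int d N hd hN x c h0 hc) hc⟩
end

section
/- Let K be an algebraically closed field of characteristic zero, let d ≥ 2 and M ≥ 1 be integers, and let x, c ∈ K. Suppose that x has preperiod strictly less than M under f_{d,c} (i.e., f_{d,c}^{M-1}(x) is periodic), and that there exists a d-th root of unity ζ ≠ 1 in K such that ζ·f_{d,c}^{M-1}(x) is periodic under f_{d,c}. Then f_{d,c}^{M-1}(x) = 0; in particular, 0 is periodic under f_{d,c}. -/
open Function

/-- `x` is a periodic point of `φ`. -/
def IsPer {K : Type*} (φ : K → K) (x : K) : Prop := ∃ n : ℕ, 0 < n ∧ φ^[n] x = x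

/-- If `f_{d,c}^{M-1}(x)` is periodic (i.e. `x` has preperiod `< M`) and `ζ f_{d,c}^{M-1}(x)`
is also periodic for some `d`-th root of unity `ζ ≠ 1`, then `f_{d,c}^{M-1}(x) = 0`; in
particular `0` is periodic under `f_{d,c}`. -/
theorem smaller_preperiod_forces_zero (K : Type*) [Field K] [IsAlgClosed K] [CharZero K]
    (d M : ℕ) (hd : 2 ≤ d) (hM : 1 ≤ M) (x c : K)
    (hper : IsPer (fun z => z ^ d + c) ((fun z : K => z ^ d + c)^[M - 1] x))
    (ζ : K) (hζd : ζ ^ d = 1) (hζ1 : ζ ≠ 1)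
    (hζper : IsPer (fun z => z ^ d + c) (ζ * (fun z : K => z ^ d + c)^[M - 1] x)) :
    (fun z : K => z ^ d + c)^[M - 1] x = 0 ∧ IsPer (fun z => z ^ d + c) (0 : K) := by
  generalize hy : (fun z : K => z ^ d + c)^[M - 1] x = y at *
  have hper0 := hper
  obtain ⟨n, hn, h1⟩ := hper
  obtain ⟨m, hm, h2⟩ := hζper
  have key : ζ * y = y := by
    have e1 : IsPeriodicPt (fun z : K => z ^ d + c) (n * m) y :=
      IsPeriodicPt.mul_const h1 m
    have e2 : IsPeriodicPt (fun z : K => z ^ d + c) (n * m) (ζ * y) :=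
      IsPeriodicPt.const_mul h2 n
    obtain ⟨k, hk⟩ : ∃ k, n * m = k + 1 := ⟨n * m - 1, by have := Nat.mul_pos hn hm; omega⟩
    rw [hk] at e1 e2
    unfold IsPeriodicPt IsFixedPt at e1 e2
    rw [iterate_succ_apply] at e1 e2
    simp only [mul_pow, hζd, one_mul] at e1 e2
    exact e2.symm.trans e1
  have hy0 : y = 0 := by
    by_contra h
    exact hζ1 (mul_right_cancel₀ h (key.trans (one_mul y).symm))
  exact ⟨hy0, hy0 ▸ hper0⟩
end

section
/- Let K be an algebraically closed field of characteristic zero, and let M, N, d be integers with N ≥ 1, M ≥ 2, d ≥ 2, and (M,N,d) ≠ (2,2,2). Let ζ ∈ K be a primitive d-th root of unity, and let x, c ∈ K satisfy f_{d,c}^{M-1}(x) = 0 and suppose 0 has exact period N under f_{d,c}. In the polynomial ring K[C], define G_0 := x (constant) and G_{k+1} := G_k^d + C, and set g := G_{M+N-1} − ζ·G_{M-1} ∈ K[C]. Then c is a simple root of g: (C − c) divides g but (C − c)² does not divide g. -/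
open Function Polynomial

/-- `Giter K d x k ∈ K[C]` is the `k`-th iterate of `z ↦ z^d + C` applied to the constant
`x`, so that `(Giter K d x k).eval c = f_{d,c}^k(x)`. -/
noncomputable def Giter (K : Type*) [CommRing K] (d : ℕ) (x : K) : ℕ → Polynomial K
  | 0 => C x
  | k + 1 => Giter K d x k ^ d + X

def aS {R : Type*} [CommRing R] (d : ℕ) (c x : R) : ℕ → R
  | 0 => x
  | k + 1 => aS d c x k ^ d + c

def dS {R : Type*} [CommRing R] (d : ℕ) (c x : R) : ℕ → R
  | 0 => 0
  | k + 1 => d * aS d c x k ^ (d - 1) * dS d c x k + 1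

lemma aS_iter {R : Type*} [CommRing R] (d : ℕ) (c x : R) (k : ℕ) :
    (fun z : R => z ^ d + c)^[k] x = aS d c x k := by
  induction k with
  | zero => rfl
  | succ k ih => rw [Function.iterate_succ_apply', ih]; rfl

lemma eval_G {K : Type*} [CommRing K] (d : ℕ) (c x : K) (k : ℕ) :
    (Giter K d x k).eval c = aS d c x k := by
  induction k with
  | zero => simp [Giter, aS]
  | succ k ih => simp [Giter, aS, ih]

lemma eval_dG {K : Type*} [CommRing K] (d : ℕ) (c x : K) (k : ℕ) :
    (derivative (Giter K d x k)).eval c = dS d c x k := by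
  induction k with
  | zero => simp [Giter, dS]
  | succ k ih => simp [Giter, dS, ih, derivative_pow, eval_G]

lemma aS_map {R S : Type*} [CommRing R] [CommRing S] (φ : R →+* S) (d : ℕ) (c x : R) (k : ℕ) :
    φ (aS d c x k) = aS d (φ c) (φ x) k := by
  induction k with
  | zero => rfl
  | succ k ih => simp [aS, ih]

lemma dS_map {R S : Type*} [CommRing R] [CommRing S] (φ : R →+* S) (d : ℕ) (c x : R) (k : ℕ) :
    φ (dS d c x k) = dS d (φ c) (φ x) k := by
  induction k with
  | zero => simp [dS]
  | succ k ih => simp [dS, ih, aS_map]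

lemma aS_shift {R : Type*} [CommRing R] (d : ℕ) (c x : R) (m : ℕ) (h : aS d c x m = 0) (k : ℕ) :
    aS d c x (m + k) = aS d c 0 k := by
  induction k with
  | zero => exact h
  | succ k ih => rw [← add_assoc]; simp [aS, ih]

lemma dS_shift {R : Type*} [CommRing R] (d : ℕ) (hd : 2 ≤ d) (c x : R) (m : ℕ)
    (h : aS d c x m = 0) (k : ℕ) :
    dS d c x (m + k + 1) = dS d c 0 (k + 1) := by
  induction k with
  | zero => simp [dS, aS, h, show d - 1 ≠ 0 by omega]
  | succ k ih =>
    rw [← add_assoc, dS, ih, dS.eq_2 d c 0 (k + 1), add_assoc m k 1, aS_shift d c x m h]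

lemma dS_one {R : Type*} [CommRing R] (d : ℕ) (c x : R) (k : ℕ) :
    (d : R) ∣ dS d c x (k + 1) - 1 := by
  simp only [dS, add_sub_cancel_right, mul_assoc]
  exact dvd_mul_right _ _

lemma core_big {R : Type*} [CommRing R] [IsDomain R] [CharZero R]
    (h : ∀ n : ℕ, 2 ≤ n → ¬ (n : R) ∣ 1) (d : ℕ) (hd : 3 ≤ d) (ζ : R)
    (hζ : IsPrimitiveRoot ζ d) (u v : R) (hu : (d : R) ∣ u - 1) (hv : (d : R) ∣ v - 1) :
    u ≠ ζ * v := by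
  intro he
  have h1 : (d : R) ∣ 1 - ζ := by
    have : 1 - ζ = ζ * (v - 1) - (u - 1) := by rw [he]; ring
    rw [this]
    exact dvd_sub (hv.mul_left _) hu
  obtain ⟨n, rfl⟩ : ∃ n, d = n + 1 := ⟨d - 1, by omega⟩
  have h2 := hζ.prod_one_sub_pow_eq_order
  have h3 : ((n + 1 : ℕ) : R) ^ n ∣ ∏ k ∈ Finset.range n, (1 - ζ ^ (k + 1)) := by
    have := Finset.prod_dvd_prod_of_dvd (s := Finset.range n)
      (fun _ => ((n + 1 : ℕ) : R)) (fun k => 1 - ζ ^ (k + 1)) (fun k _ => by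
        refine h1.trans ?_
        simpa using sub_dvd_pow_sub_pow (1 : R) ζ (k + 1))
    simpa using this
  rw [h2] at h3
  have h4 : ((n + 1 : ℕ) : R) ^ 2 ∣ ((n + 1 : ℕ) : R) := by
    refine (pow_dvd_pow _ (by omega)).trans (h3.trans ?_)
    push_cast; rfl
  obtain ⟨w, hw⟩ := h4
  have hne : ((n + 1 : ℕ) : R) ≠ 0 := Nat.cast_ne_zero.mpr (by omega)
  refine h (n + 1) (by omega) ⟨w, mul_left_cancel₀ hne ?_⟩
  linear_combination hw

lemma core_two {R : Type*} [CommRing R] [IsDomain R] [CharZero R]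
    (h : ¬ (2 : R) ∣ 1) (m n : ℕ) (hmn : ¬ (m = 0 ∧ n = 1)) (c x : R)
    (hx : aS 2 c x (m + 1) = 0) (h0 : aS 2 c 0 (n + 1) = 0)
    (hmin : ∀ k, 0 < k → aS 2 c 0 k = 0 → n + 1 ≤ k) :
    dS 2 c 0 (n + 1) + dS 2 c x (m + 1) ≠ 0 := by
  intro he
  have two : (2 : R) ≠ 0 := two_ne_zero
  have hs : 1 + aS 2 c 0 n * dS 2 c 0 n + aS 2 c x m * dS 2 c x m = 0 := by
    apply mul_left_cancel₀ two
    simp only [dS] at he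
    push_cast at he
    simp only [pow_one] at he
    linear_combination he
  simp only [aS] at hx h0
  rcases m with _ | m
  · -- the case of `M = 2`
    simp only [dS, mul_zero, add_zero] at hs
    rcases n with _ | _ | n
    · simp [dS] at hs
    · simp at hmn
    · obtain ⟨w, hw⟩ := dS_one 2 c (0 : R) (n + 1)
      push_cast at hw
      set g := aS 2 c 0 (n + 1 + 1) with hg
      have hw' : dS 2 c (0 : R) (n + 1 + 1) = 1 + 2 * w := by linear_combination hw
      rw [hw'] at hs
      obtain ⟨e, hce⟩ : ∃ e, c = -1 + 2 * e := by
        refine ⟨- 2 * (g * w) * (g * w) - 2 * (g*w) , ?_⟩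
        have : g = -1 - 2 * (g * w) := by linear_combination hs
        have h5 : g ^ 2 = (-1 - 2 * (g * w)) ^ 2 := by rw [← this]
        linear_combination h0 - h5
      have key : ∀ k, ∃ s, aS 2 c 0 (2 * k + 2) = (c + 1) * (1 + 2 * s) := by
        intro k
        induction k with
        | zero => exact ⟨-1 + e, by simp [aS]; rw [hce]; ring⟩
        | succ k ih =>
          obtain ⟨s, hs⟩ := ih
          refine ⟨-1 + e + e * (c+1)^2 * (1 + 2 * s)^4 + c * (c + 1) * (1 + 2 * s)^2, ?_⟩
          rw [show 2 * (k + 1) + 2 = (2 * k + 2) + 1 + 1 by ring, aS, aS, hs, hce]; ring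
      rcases Nat.even_or_odd' (n + 1) with ⟨k, hk | hk⟩
      · obtain ⟨s, hs'⟩ := key k
        have h6 : (c + 1) * (1 + 2 * s) = 0 := by
          rw [← hs', show 2 * k + 2 = n + 1 + 1 + 1 by omega, aS, ← hg]; exact h0
        rcases mul_eq_zero.mp h6 with h7 | h7
        · have := hmin 2 (by norm_num) (by simp [aS]; linear_combination c * h7)
          omega
        · exact h ⟨-s, by linear_combination h7⟩
      · obtain ⟨s, hs'⟩ := key k
        rw [show 2 * k + 2 = n + 1 + 1 by omega, ← hg] at hs'
        rw [hs', hce] at h0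
        exact h ⟨e + 2 * e ^ 2 * (1 + 2 * s) ^ 2, by linear_combination -h0⟩
  · obtain ⟨w, hw⟩ := dS_one 2 c x m
    push_cast at hw
    have hw' : dS 2 c x (m + 1) = 1 + 2 * w := by linear_combination hw
    rw [hw'] at hs
    have hv : ∃ v, aS 2 c 0 n * dS 2 c 0 n = aS 2 c 0 n * (1 + 2 * v) := by
      rcases n with _ | n
      · exact ⟨0, by simp [aS]⟩
      · obtain ⟨v, hv⟩ := dS_one 2 c (0 : R) n
        push_cast at hv
        exact ⟨v, by rw [show dS 2 c (0 : R) (n + 1) = 1 + 2 * v by linear_combination hv]⟩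
    obtain ⟨v, hv⟩ := hv
    rw [hv] at hs
    have hsq : aS 2 c x (m + 1) ^ 2 = aS 2 c 0 n ^ 2 := by
      simp only [aS] at hx ⊢
      linear_combination hx - h0
    rcases sq_eq_sq_iff_eq_or_eq_neg.mp hsq with h8 | h8
    · rw [h8] at hs
      exact h ⟨-(aS 2 c 0 n * (1 + v + w)), by linear_combination hs⟩
    · rw [h8] at hs
      exact h ⟨-(aS 2 c 0 n * (v - w)), by linear_combination hs⟩

lemma c_int_s16 {K : Type*} [Field K] (d : ℕ) (hd : 2 ≤ d) (c : K) (n : ℕ)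
    (h : aS d c 0 (n + 1) = 0) : IsIntegral ℤ c := by
  have key : ∀ k, (Giter ℤ d 0 (k + 1)).Monic ∧ 1 ≤ (Giter ℤ d 0 (k + 1)).natDegree := by
    intro k
    induction k with
    | zero => simp [Giter, show d ≠ 0 by omega]
    | succ k ih =>
      obtain ⟨h1, h2⟩ := ih
      rw [Giter]
      have h3 : (X : ℤ[X]).natDegree < (Giter ℤ d 0 (k + 1) ^ d).natDegree := by
        rw [h1.natDegree_pow, natDegree_X]; nlinarith
      refine ⟨(h1.pow d).add_of_left (degree_lt_degree h3), ?_⟩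
      rw [natDegree_add_eq_left_of_natDegree_lt h3]
      exact Nat.one_le_iff_ne_zero.mpr (by omega)
  refine ⟨_, (key n).1, ?_⟩
  have : ∀ k, eval₂ (algebraMap ℤ K) c (Giter ℤ d 0 k) = aS d c 0 k := by
    intro k
    induction k with
    | zero => simp [Giter, aS]
    | succ k ih => simp only [Giter, aS, eval₂_add, eval₂_pow, ih, eval₂_X]
  rw [this, h]

lemma x_int_s16 {K : Type*} [Field K] (d : ℕ) (hd : 2 ≤ d) (c x : K) (hc : IsIntegral ℤ c) (m : ℕ)
    (h : IsIntegral ℤ (aS d c x m)) : IsIntegral ℤ x := by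
  induction m with
  | zero => exact h
  | succ m ih =>
    apply ih
    apply IsIntegral.of_pow (n := d) (by omega)
    have := h.sub hc
    simpa [aS] using this

/-- If `M ≥ 2`, `d ≥ 2`, `(M,N,d) ≠ (2,2,2)`, `ζ` is a primitive `d`-th root of unity,
`f_{d,c}^{M-1}(x) = 0`, and `0` has exact period `N` under `f_{d,c}`, then `c` is a simple
root of `G_{M+N-1} - ζ G_{M-1} ∈ K[C]`. -/
theorem simple_root_of_psi (K : Type*) [Field K] [IsAlgClosed K] [CharZero K]
    (M N d : ℕ) (hN : 1 ≤ N) (hM : 2 ≤ M) (hd : 2 ≤ d)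
    (hMNd : ¬(M = 2 ∧ N = 2 ∧ d = 2))
    (ζ : K) (hζ : IsPrimitiveRoot ζ d) (x c : K)
    (hx : (fun z : K => z ^ d + c)^[M - 1] x = 0)
    (h0 : ExactPeriod (fun z => z ^ d + c) (0 : K) N) :
    (X - C c) ∣ (Giter K d x (M + N - 1) - C ζ * Giter K d x (M - 1)) ∧
    ¬ ((X - C c) ^ 2 ∣ (Giter K d x (M + N - 1) - C ζ * Giter K d x (M - 1))) := by
  have hNm := h0.2.1
  have hmin := h0.2.2
  simp only [aS_iter] at hx hNm hmin
  obtain ⟨m, rfl⟩ : ∃ m, M = m + 1 + 1 := ⟨M - 2, by omega⟩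
  obtain ⟨n, rfl⟩ : ∃ n, N = n + 1 := ⟨N - 1, by omega⟩
  simp only [Nat.add_sub_cancel] at hx ⊢
  rw [show m + 1 + 1 + (n + 1) - 1 = m + 1 + n + 1 by omega]
  have main : dS d c 0 (n + 1) ≠ ζ * dS d c x (m + 1) := by
    have hc := c_int_s16 d hd c n hNm
    have hxi := x_int_s16 d hd c x hc (m + 1) (by rw [hx]; exact isIntegral_zero)
    have hζi : IsIntegral ℤ ζ := hζ.isIntegral (by omega)
    let R := integralClosure ℤ K
    let φ : R →+* K := algebraMap R K
    have hφ : Function.Injective φ := Subtype.val_injective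
    have hR : ∀ n : ℕ, 2 ≤ n → ¬ (n : R) ∣ 1 := by
      rintro n hn ⟨w, hw⟩
      have h1 : IsIntegral ℤ (algebraMap ℚ K (1 / (n : ℚ))) := by
        have h2 : (w : K) = algebraMap ℚ K (1 / (n : ℚ)) := by
          have h3 := congrArg φ hw
          simp only [map_one, map_mul, map_natCast] at h3
          have hn0 : (n : K) ≠ 0 := Nat.cast_ne_zero.mpr (by omega)
          simp only [map_div₀, map_one, map_natCast]
          rw [eq_div_iff hn0, h3, mul_comm]; rfl
        rw [← h2]; exact w.2
      rw [isIntegral_algebraMap_iff (algebraMap ℚ K).injective] at h1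
      obtain ⟨z, hz⟩ := IsIntegrallyClosed.isIntegral_iff.mp h1
      have hn0 : (n : ℚ) ≠ 0 := Nat.cast_ne_zero.mpr (by omega)
      rw [eq_div_iff hn0] at hz
      have hz' : z * (n : ℤ) = 1 := by
        rw [eq_intCast] at hz
        exact_mod_cast hz
      have := Int.le_of_dvd one_pos (Dvd.intro_left z hz')
      omega
    let c' : R := ⟨c, hc⟩
    let x' : R := ⟨x, hxi⟩
    let ζ' : R := ⟨ζ, hζi⟩
    have hζ' : IsPrimitiveRoot ζ' d := IsPrimitiveRoot.of_map_of_injective (f := φ) hζ hφ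
    have ea : ∀ k, φ (aS d c' 0 k) = aS d c 0 k := fun k => by
      rw [aS_map, map_zero]; rfl
    have eax : ∀ k, φ (aS d c' x' k) = aS d c x k := fun k => aS_map φ d c' x' k
    have ed : ∀ k, φ (dS d c' 0 k) = dS d c 0 k := fun k => by
      rw [dS_map, map_zero]; rfl
    have edx : ∀ k, φ (dS d c' x' k) = dS d c x k := fun k => dS_map φ d c' x' k
    have mainR : dS d c' 0 (n + 1) ≠ ζ' * dS d c' x' (m + 1) := by
      rcases Nat.lt_or_ge 2 d with h3 | h3
      · exact core_big hR d h3 ζ' hζ' _ _ (dS_one _ _ _ _) (dS_one _ _ _ _)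
      · obtain rfl : d = 2 := by omega
        rw [hζ'.eq_neg_one_of_two_right]
        have := core_two (R := R) (by simpa using hR 2 le_rfl) m n (by omega) c' x'
          (hφ (by rw [eax, hx, map_zero])) (hφ (by rw [ea, hNm, map_zero]))
          (fun k hk h => hmin k hk (by rw [← ea, h, map_zero]))
        intro he
        apply this
        rw [he]; ring
    intro he
    apply mainR
    apply hφ
    rw [map_mul, ed, edx]
    exact he
  have hroot : eval c (Giter K d x (m + 1 + n + 1) - C ζ * Giter K d x (m + 1)) = 0 := by
    simp only [eval_sub, eval_mul, eval_C, eval_G, hx]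
    rw [add_assoc (m + 1), aS_shift d c x (m + 1) hx, hNm]; simp
  refine ⟨dvd_iff_isRoot.mpr hroot, ?_⟩
  rintro ⟨q, hq⟩
  have hder := congrArg (fun p => eval c (derivative p)) hq
  simp only [derivative_sub, derivative_mul, derivative_C, eval_sub, eval_add, eval_mul, eval_C,
    eval_dG, zero_mul, eval_zero, zero_add, derivative_pow] at hder
  rw [dS_shift d hd c x (m + 1) hx] at hder
  apply main
  simp at hder
  linear_combination hder
end

section
/- Let K be an algebraically closed field of characteristic zero, let x ∈ K, and let M ≥ 0, N ≥ 1, d ≥ 2 be integers. Suppose (x,M,N,d) is not one of (-1/2, 0, 2, 2) and (1/2, 1, 2, 2). Then there exists c ∈ K such that f_{d,c}^M(x) has exact period N under f_{d,c}; equivalently, x is preperiodic under f_{d,c} with preperiod at most M and eventual period exactly N. -/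
open Function

open Polynomial in
/-- `orb x d n` is the `n`-th iterate of `x` as a polynomial in the parameter `c`. -/
noncomputable def orb {K : Type*} [Field K] (x : K) (d : ℕ) : ℕ → Polynomial K
  | 0 => C x
  | n + 1 => orb x d n ^ d + X

open Polynomial in
theorem orb_eval {K : Type*} [Field K] (x : K) (d : ℕ) (c : K) (n : ℕ) :
    (orb x d n).eval c = (fun z : K => z ^ d + c)^[n] x := by
  induction n with
  | zero => simp [orb]
  | succ n ih => rw [Function.iterate_succ_apply', ← ih]; simp [orb]

open Polynomial in
theorem orb_monic {K : Type*} [Field K] (x : K) (d : ℕ) (hd : 2 ≤ d) (n : ℕ) :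
    (orb x d (n+1)).Monic ∧ (orb x d (n+1)).natDegree = d ^ n := by
  induction n with
  | zero =>
    have : orb x d 1 = X + C (x ^ d) := by simp [orb, add_comm]
    rw [this]
    exact ⟨monic_X_add_C _, by rw [natDegree_X_add_C, pow_zero]⟩
  | succ n ih =>
    obtain ⟨hm, hdeg⟩ := ih
    have e : orb x d (n+1+1) = orb x d (n+1) ^ d + X := rfl
    have hm' := hm.pow d
    have hdeg' : (orb x d (n+1) ^ d).natDegree = d ^ (n+1) := by
      rw [hm.natDegree_pow, hdeg, pow_succ, mul_comm]
    have hlt : (X : K[X]).natDegree < (orb x d (n+1) ^ d).natDegree := by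
      rw [hdeg', natDegree_X]
      exact Nat.one_lt_pow (by omega) (by omega)
    have hlt' : (X : K[X]).degree < (orb x d (n+1) ^ d).degree := degree_lt_degree hlt
    rw [e]
    exact ⟨hm'.add_of_left hlt', by rw [natDegree_add_eq_left_of_natDegree_lt hlt, hdeg']⟩

open Polynomial in
theorem card_roots_bound {K : Type*} [Field K] [IsAlgClosed K] [CharZero K] [DecidableEq K]
    (x : K) (d e : ℕ) (hd : 2 ≤ d) (he : 1 ≤ e) (Q : K[X]) (hQ : Q.Monic)
    (hdeg : Q.natDegree = e) (F : K[X]) (hF : F = Q ^ d + (X - C x)) (hF0 : F ≠ 0) :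
    F.natDegree ≤ e + F.roots.toFinset.card := by
  set W : K[X] := C (d : K) * (derivative Q * (X - C x)) - Q with hW
  have hWF : W = C (d : K) * derivative Q * F - Q * derivative F := by
    obtain ⟨k, rfl⟩ : ∃ k, d = k + 1 := ⟨d - 1, by omega⟩
    rw [hF, hW]
    simp only [derivative_add, derivative_sub, derivative_X, derivative_C, derivative_pow_succ]
    simp
    ring
  have hdQ : (derivative Q).natDegree ≤ e - 1 := hdeg ▸ natDegree_derivative_le Q
  have hWdeg : W.natDegree ≤ e := by
    rw [hW]
    refine (natDegree_sub_le _ _).trans (max_le ?_ hdeg.le)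
    refine (natDegree_C_mul_le _ _).trans (natDegree_mul_le.trans ?_)
    rw [natDegree_X_sub_C]; omega
  have hW0 : W ≠ 0 := by
    obtain ⟨k, rfl⟩ : ∃ k, e = k + 1 := ⟨e - 1, by omega⟩
    intro h0
    have h1 : W.coeff (k+1) = 0 := by rw [h0]; simp
    have hQc : Q.coeff (k+1) = 1 := by rw [← hdeg]; exact hQ
    have hz : Q.coeff (k+1+1) = 0 := coeff_eq_zero_of_natDegree_lt (by omega)
    rw [hW, coeff_sub, coeff_C_mul, mul_sub, coeff_sub, coeff_mul_X, coeff_mul_C,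
      coeff_derivative, coeff_derivative, hz, hQc] at h1
    have h2 : ((d * (k+1) : ℕ) : K) = (1 : ℕ) := by push_cast; linear_combination h1
    have h3 : d * (k+1) = 1 := by exact_mod_cast h2
    nlinarith
  set R : K[X] := ∏ a ∈ F.roots.toFinset, (X - C a) with hR
  have hR0 : R ≠ 0 := Finset.prod_ne_zero_iff.mpr fun a _ => X_sub_C_ne_zero a
  have hWR : W * R ≠ 0 := mul_ne_zero hW0 hR0
  have hdvd : F ∣ W * R := by
    rw [IsAlgClosed.dvd_iff_roots_le_roots hF0 hWR, Multiset.le_iff_count]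
    intro a
    rw [count_roots, count_roots, rootMultiplicity_mul hWR]
    by_cases ha : F.IsRoot a
    · have hR1 : 1 ≤ rootMultiplicity a R := by
        rw [Nat.one_le_iff_ne_zero, ← Nat.pos_iff_ne_zero, rootMultiplicity_pos hR0]
        rw [IsRoot, hR, eval_prod]
        exact Finset.prod_eq_zero (i := a) (by simp [hF0]; exact ha) (by simp)
      have hp := pow_rootMultiplicity_dvd F a
      have hW1 : F.rootMultiplicity a - 1 ≤ W.rootMultiplicity a := by
        rw [le_rootMultiplicity_iff hW0, hWF]
        exact dvd_sub (((pow_dvd_pow _ (Nat.sub_le _ _)).trans hp).mul_left _)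
          ((pow_sub_one_dvd_derivative_of_pow_dvd hp).mul_left _)
      omega
    · rw [rootMultiplicity_eq_zero ha]; omega
  have := natDegree_le_of_dvd hdvd hWR
  rw [natDegree_mul hW0 hR0, hR, natDegree_prod_of_monic _ _ fun a _ => monic_X_sub_C a] at this
  simp at this
  omega

theorem arith_bound (d n : ℕ) (hd : 2 ≤ d) (h : ¬ (n = 0 ∧ d = 2)) :
    ∑ j ∈ Finset.range ((n+2)/2), d ^ j + d ^ n < d ^ (n+1) := by
  rcases Nat.eq_zero_or_pos n with rfl | hn
  · simp; omega
  · have := Nat.geomSum_lt (m := d) (n := n) (s := Finset.range ((n+2)/2)) hd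
      (fun k hk => by rw [Finset.mem_range] at hk; omega)
    have h2 : d ^ n * 2 ≤ d ^ n * d := Nat.mul_le_mul_left _ hd
    rw [pow_succ]; omega

open Polynomial in
theorem exact_zero {K : Type*} [Field K] [IsAlgClosed K] [CharZero K]
    (x : K) (n d : ℕ) (hd : 2 ≤ d) (h : ¬ (n = 0 ∧ d = 2)) :
    ∃ c : K, ExactPeriod (fun z => z ^ d + c) x (n+2) := by
  classical
  have hdegs : ∀ j, (orb x d (j+1) - C x).natDegree = d ^ j := fun j => by
    rw [natDegree_sub_C, (orb_monic x d hd j).2]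
  have hne : ∀ j, orb x d (j+1) - C x ≠ 0 := fun j h0 => by
    have := hdegs j
    rw [h0, natDegree_zero] at this
    have : 0 < d ^ j := by positivity
    omega
  have hb := card_roots_bound x d (d ^ n) hd (Nat.one_le_pow _ _ (by omega)) (orb x d (n+1))
    (orb_monic x d hd n).1 (orb_monic x d hd n).2 (orb x d (n+1+1) - C x)
    (by simp only [orb]; ring) (hne _)
  rw [hdegs] at hb
  have ha := arith_bound d n hd h
  set B : Finset K := (Finset.range ((n+2)/2)).biUnion
    fun j => (orb x d (j+1) - C x).roots.toFinset with hB
  have hBc : B.card ≤ ∑ j ∈ Finset.range ((n+2)/2), d ^ j := by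
    refine Finset.card_biUnion_le.trans (Finset.sum_le_sum fun j _ => ?_)
    exact (Multiset.toFinset_card_le _).trans ((card_roots' _).trans (hdegs j).le)
  obtain ⟨c, hc, hcB⟩ := Finset.exists_mem_notMem_of_card_lt_card
    (s := B) (t := (orb x d (n+1+1) - C x).roots.toFinset) (by omega)
  have key : ∀ j, c ∈ (orb x d (j+1) - C x).roots.toFinset ↔
      (fun z : K => z ^ d + c)^[j+1] x = x := fun j => by
    rw [Multiset.mem_toFinset, mem_roots (hne j), IsRoot, eval_sub, orb_eval, eval_C, sub_eq_zero]
  rw [key] at hc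
  refine ⟨c, by omega, hc, fun m hm hmx => ?_⟩
  set f := (fun z : K => z ^ d + c) with hf
  have hper : Function.IsPeriodicPt f (n+2) x := hc
  have hdv := hper.minimalPeriod_dvd
  have hpos := hper.minimalPeriod_pos (by omega)
  have hle : Function.minimalPeriod f x ≤ m :=
    Function.IsPeriodicPt.minimalPeriod_le hm hmx
  refine le_trans ?_ hle
  by_contra hlt
  push Not at hlt
  obtain ⟨q, hq⟩ := hdv
  have hq2 : 2 ≤ q := by
    by_contra h2
    have : q = 0 ∨ q = 1 := by omega
    rcases this with rfl | rfl <;> omega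
  have hhalf : Function.minimalPeriod f x ≤ (n+2)/2 := by
    rw [Nat.le_div_iff_mul_le (by norm_num), hq]
    exact Nat.mul_le_mul_left _ hq2
  apply hcB
  rw [hB, Finset.mem_biUnion]
  refine ⟨Function.minimalPeriod f x - 1, by rw [Finset.mem_range]; omega, ?_⟩
  rw [key, Nat.sub_add_cancel hpos]
  exact Function.iterate_minimalPeriod

theorem ExactPeriod.map {K : Type*} {f : K → K} {x : K} {N : ℕ} (h : ExactPeriod f x N) :
    ExactPeriod f (f x) N := by
  obtain ⟨h0, h1, h2⟩ := h
  refine ⟨h0, ?_, fun n hn hx => h2 n hn ?_⟩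
  · rw [← Function.iterate_succ_apply, Function.iterate_succ_apply', h1]
  · have hc : ∀ k, f^[n] (f^[k+1] x) = f^[k+1] x := fun k => by
      rw [← Function.iterate_add_apply, show n + (k+1) = k + (n + 1) by omega,
        Function.iterate_add_apply, Function.iterate_succ_apply, hx,
        Function.iterate_succ_apply]
    obtain ⟨k, rfl⟩ : ∃ k, N = k + 1 := ⟨N - 1, by omega⟩
    simpa [h1] using hc k

theorem ExactPeriod.iter {K : Type*} {f : K → K} {x : K} {N : ℕ} (h : ExactPeriod f x N)
    (M : ℕ) : ExactPeriod f (f^[M] x) N := by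
  induction M with
  | zero => exact h
  | succ M ih => rw [Function.iterate_succ_apply']; exact ih.map

theorem exactPeriod_two {K : Type*} {f : K → K} {x : K} (h : f (f x) = x) (h' : f x ≠ x) :
    ExactPeriod f x 2 := by
  refine ⟨by norm_num, h, fun n hn hx => ?_⟩
  by_contra hlt
  obtain rfl : n = 1 := by omega
  exact h' hx

/-- If `(x,M,N,d)` is neither `(-1/2,0,2,2)` nor `(1/2,1,2,2)`, then there is `c ∈ K`
such that `f_{d,c}^M(x)` has exact period `N` under `f_{d,c}`. -/
theorem exists_c_eventual_period (K : Type*) [Field K] [IsAlgClosed K] [CharZero K]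
    (x : K) (M N d : ℕ) (hN : 1 ≤ N) (hd : 2 ≤ d)
    (h1 : ¬(x = -(1 / 2 : K) ∧ M = 0 ∧ N = 2 ∧ d = 2))
    (h2 : ¬(x = (1 / 2 : K) ∧ M = 1 ∧ N = 2 ∧ d = 2)) :
    ∃ c : K, ExactPeriod (fun z => z ^ d + c) ((fun z : K => z ^ d + c)^[M] x) N := by
  obtain rfl | hN2 : N = 1 ∨ 2 ≤ N := by omega
  · refine ⟨x - x ^ d, ExactPeriod.iter ⟨by norm_num, by simp, fun n hn _ => hn⟩ M⟩
  obtain ⟨n, rfl⟩ : ∃ n, N = n + 2 := ⟨N - 2, by omega⟩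
  by_cases h : n = 0 ∧ d = 2
  · obtain ⟨rfl, rfl⟩ := h
    by_cases hx : x = -(1/2 : K)
    · have hM : M ≠ 0 := fun hM => h1 ⟨hx, hM, rfl, rfl⟩
      obtain ⟨m, rfl⟩ : ∃ m, M = m + 1 := ⟨M - 1, by omega⟩
      refine ⟨-(7/4), ?_⟩
      rw [Function.iterate_succ_apply]
      refine ExactPeriod.iter (exactPeriod_two ?_ ?_) m
      · subst hx; norm_num
      · subst hx; norm_num
    · refine ⟨-(x^2+x+1), ExactPeriod.iter (exactPeriod_two ?_ ?_) M⟩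
      · ring
      · intro h0
        apply hx
        linear_combination (-1/2 : K) * h0
  · obtain ⟨c, hc⟩ := exact_zero x n d hd h
    exact ⟨c, hc.iter M⟩
end

section
/- Let K be an algebraically closed field of characteristic zero, let x ∈ K, and let M ≥ 1, N ≥ 1, d ≥ 2 be integers. Suppose (x,M) ≠ (0,1) and (x,M,N,d) is not one of (1, 2, 2, 2) and (-1, 2, 2, 2). Then there exists c ∈ K such that f_{d,c}^{M+N}(x) = f_{d,c}^M(x) and x has preperiod exactly M under f_{d,c}; that is, x is preperiodic with preperiod exactly M and eventual period dividing N. -/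
open Function

open Polynomial in
/-- The polynomial in `c` giving the `k`-th iterate of `x`. -/
noncomputable def itP {K : Type*} [Field K] (x : K) (d : ℕ) : ℕ → K[X]
  | 0 => C x
  | k + 1 => itP x d k ^ d + X

open Polynomial

section aux
variable {K : Type*} [Field K]

lemma itP_eval (x : K) (d : ℕ) (c : K) (k : ℕ) :
    (itP x d k).eval c = (fun z : K => z ^ d + c)^[k] x := by
  induction k with
  | zero => simp [itP]
  | succ k ih => rw [iterate_succ_apply', ← ih]; simp [itP]

lemma itP_monic (x : K) (d : ℕ) (hd : 2 ≤ d) (k : ℕ) :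
    (itP x d (k + 1)).Monic ∧ (itP x d (k + 1)).natDegree = d ^ k := by
  induction k with
  | zero =>
    have : itP x d (0 + 1) = X + C (x ^ d) := by simp [itP, add_comm]
    rw [this]
    exact ⟨monic_X_add_C _, by rw [natDegree_X_add_C]; simp⟩
  | succ k ih =>
    have hpow : (itP x d (k + 1) ^ d).Monic := ih.1.pow d
    have hdeg : (itP x d (k + 1) ^ d).natDegree = d ^ (k + 1) := by
      rw [ih.1.natDegree_pow, ih.2, pow_succ, mul_comm]
    have h1 : 1 < d ^ (k + 1) := Nat.one_lt_pow (by omega) (by omega)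
    have hlt : (X : K[X]).natDegree < (itP x d (k + 1) ^ d).natDegree := by
      rw [hdeg, natDegree_X]; exact h1
    have e : itP x d (k + 1 + 1) = itP x d (k + 1) ^ d + X := rfl
    rw [e]
    exact ⟨hpow.add_of_left (degree_lt_degree hlt),
      by rw [natDegree_add_eq_left_of_natDegree_lt hlt, hdeg]⟩

lemma final_step (x c ζ : K) (d m N : ℕ) (hζ : ζ ^ d = 1) (hζ1 : ζ ≠ 1)
    (h : (fun z : K => z ^ d + c)^[m + N] x = ζ * (fun z : K => z ^ d + c)^[m] x)
    (h0 : (fun z : K => z ^ d + c)^[m] x ≠ 0) :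
    (fun z : K => z ^ d + c)^[m + 1 + N] x = (fun z : K => z ^ d + c)^[m + 1] x ∧
      ∀ m' n : ℕ, 0 < n →
        (fun z : K => z ^ d + c)^[m' + n] x = (fun z : K => z ^ d + c)^[m'] x → m + 1 ≤ m' := by
  set f : K → K := fun z : K => z ^ d + c with hf
  have key : f^[m + 1 + N] x = f^[m + 1] x := by
    rw [show m + 1 + N = (m + N) + 1 by ring, iterate_succ_apply', iterate_succ_apply', h]
    simp [hf, mul_pow, hζ]
  refine ⟨key, fun m' n hn hp => ?_⟩
  by_contra hlt
  obtain ⟨e, rfl⟩ : ∃ e, m = e + m' := ⟨m - m', by omega⟩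
  set y := f^[e + m'] x with hy
  have hpy : IsPeriodicPt f n y := by
    change f^[n] y = y
    rw [hy, ← iterate_add_apply, show n + (e + m') = e + (m' + n) by ring, iterate_add_apply, hp,
      ← iterate_add_apply]
  have hpf : f^[N] (f y) = f y := by
    rw [hy, ← iterate_succ_apply' f, ← iterate_add_apply, add_comm]; exact key
  have hNy : f^[N] y = ζ * y := by rw [← h, hy, ← iterate_add_apply, add_comm]
  have hn' : n = (n - 1) + 1 := by omega
  have h5 : f^[n - 1] (f y) = y := by
    have := hpy; rw [hn'] at this; exact this
  have : f^[N] y = y := by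
    conv_lhs => rw [← h5]
    rw [← iterate_add_apply, add_comm, iterate_add_apply, hpf, h5]
  rw [this] at hNy
  apply hζ1
  have : (ζ - 1) * y = 0 := by linear_combination -hNy
  rcases mul_eq_zero.1 this with h | h
  · linear_combination h
  · exact absurd h h0

lemma not_int_inv [CharZero K] (d : ℕ) (hd : 2 ≤ d) (y : K) (hy : IsIntegral ℤ y)
    (h : (d : K) * y = 1) : False := by
  have hd0 : (d : K) ≠ 0 := by exact_mod_cast (by omega : d ≠ 0)
  have e : y = algebraMap ℚ K ((d : ℚ)⁻¹) := by
    simp only [map_inv₀, map_natCast]; field_simp; linear_combination h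
  rw [e, isIntegral_algebraMap_iff (algebraMap ℚ K).injective] at hy
  obtain ⟨z, hz⟩ := IsIntegrallyClosed.isIntegral_iff.1 hy
  have hz' : (z : ℚ) = (d : ℚ)⁻¹ := by simpa using hz
  have hdq : (d : ℚ) ≠ 0 := by exact_mod_cast (by omega : d ≠ 0)
  have : (d : ℚ) * z = 1 := by rw [hz']; field_simp
  have h2 : (d : ℤ) * z = 1 := by exact_mod_cast this
  have := Int.eq_one_or_neg_one_of_mul_eq_one h2
  omega

lemma int_iter (x c : K) (d k : ℕ) (hx : IsIntegral ℤ x) (hc : IsIntegral ℤ c) :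
    IsIntegral ℤ ((fun z : K => z ^ d + c)^[k] x) := by
  induction k with
  | zero => exact hx
  | succ k ih => rw [iterate_succ_apply']; exact (ih.pow d).add hc

lemma int_of_iter (x c : K) (d k : ℕ) (hd : 2 ≤ d) (hc : IsIntegral ℤ c)
    (h : IsIntegral ℤ ((fun z : K => z ^ d + c)^[k] x)) : IsIntegral ℤ x := by
  induction k with
  | zero => exact h
  | succ k ih =>
    apply ih
    rw [iterate_succ_apply'] at h
    have := h.sub hc
    simp only [add_sub_cancel_right] at this
    exact this.of_pow (by omega)

lemma int_c (c : K) (d n : ℕ) (hd : 2 ≤ d) (h : (fun z : K => z ^ d + c)^[n + 1] 0 = 0) :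
    IsIntegral ℤ c := by
  have key : ∀ k, ∃ p : ℤ[X], p.Monic ∧ p.natDegree = d ^ k ∧
      aeval c p = (fun z : K => z ^ d + c)^[k + 1] 0 := by
    intro k
    induction k with
    | zero => exact ⟨X, monic_X, by simp, by simp [show d ≠ 0 by omega]⟩
    | succ k ih =>
      obtain ⟨p, hp, hdg, he⟩ := ih
      have hdeg : (p ^ d).natDegree = d ^ (k + 1) := by
        rw [hp.natDegree_pow, hdg, pow_succ, mul_comm]
      have h1 : 1 < d ^ (k + 1) := Nat.one_lt_pow (by omega) (by omega)
      have hlt : (X : ℤ[X]).natDegree < (p ^ d).natDegree := by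
        rw [hdeg, natDegree_X]; exact h1
      refine ⟨p ^ d + X, (hp.pow d).add_of_left (degree_lt_degree hlt),
        by rw [natDegree_add_eq_left_of_natDegree_lt hlt, hdeg], ?_⟩
      rw [iterate_succ_apply', ← he]; simp
  obtain ⟨p, hp, -, he⟩ := key n
  exact ⟨p, hp, by rw [← aeval_def, he, h]⟩

lemma int_deriv (x c : K) (d k : ℕ) (hx : IsIntegral ℤ x) (hc : IsIntegral ℤ c) :
    IsIntegral ℤ ((derivative (itP x d k)).eval c) ∧
    ∃ r : K, IsIntegral ℤ r ∧ (derivative (itP x d (k + 1))).eval c = 1 + d * r := by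
  have step : ∀ k, IsIntegral ℤ ((derivative (itP x d k)).eval c) →
      ∃ r : K, IsIntegral ℤ r ∧ (derivative (itP x d (k + 1))).eval c = 1 + d * r := by
    intro k h
    refine ⟨(itP x d k).eval c ^ (d - 1) * (derivative (itP x d k)).eval c, ?_, ?_⟩
    · rw [itP_eval]; exact ((int_iter x c d k hx hc).pow _).mul h
    · simp [itP, derivative_pow]; ring
  have h1 : ∀ k, IsIntegral ℤ ((derivative (itP x d k)).eval c) := by
    intro k
    induction k with
    | zero => simpa [itP] using isIntegral_zero
    | succ k ih =>
      obtain ⟨r, hr, e⟩ := step k ih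
      rw [e]
      have hdI : IsIntegral ℤ (d : K) := by
        simpa using (isIntegral_algebraMap (R := ℤ) (A := K) (x := (d : ℤ)))
      exact isIntegral_one.add (hdI.mul hr)
  exact ⟨h1 k, step k (h1 k)⟩

lemma bad_facts (x c : K) (d m n : ℕ) (hd : 2 ≤ d)
    (h1 : (itP x d (m + 1)).eval c = 0) (h2 : (itP x d (m + n + 2)).eval c = 0) :
    (fun z : K => z ^ d + c)^[n + 1] 0 = 0 ∧ IsIntegral ℤ c ∧ IsIntegral ℤ x := by
  rw [itP_eval] at h1 h2
  have h3 : (fun z : K => z ^ d + c)^[n + 1] 0 = 0 := by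
    rw [show m + n + 2 = (n + 1) + (m + 1) by ring, iterate_add_apply, h1] at h2
    exact h2
  have h4 := int_c c d n hd h3
  exact ⟨h3, h4, int_of_iter x c d (m + 1) hd h4 (by rw [h1]; exact isIntegral_zero)⟩

lemma Q_monic (x ζ : K) (d m n : ℕ) (hd : 2 ≤ d) :
    (itP x d (m + n + 2) - C ζ * itP x d (m + 1)).Monic ∧
    (itP x d (m + n + 2) - C ζ * itP x d (m + 1)).natDegree = d ^ (m + n + 1) := by
  obtain ⟨a1, a2⟩ := itP_monic x d hd (m + n + 1)
  obtain ⟨b1, b2⟩ := itP_monic x d hd m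
  have hlt : (C ζ * itP x d (m + 1)).natDegree < (itP x d (m + n + 2)).natDegree := by
    refine (natDegree_C_mul_le _ _).trans_lt ?_
    rw [a2, b2]
    exact Nat.pow_lt_pow_right (by omega) (by omega)
  exact ⟨a1.sub_of_left (degree_lt_degree hlt),
    by rw [natDegree_sub_eq_left_of_natDegree_lt hlt, a2]⟩

variable [IsAlgClosed K] [CharZero K]

lemma d_dvd (x ζ : K) (d m n : ℕ) (hd : 2 ≤ d) (hz : IsIntegral ℤ ζ)
    (H : ∀ c : K, (itP x d (m + n + 2)).eval c = ζ * (itP x d (m + 1)).eval c →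
      (itP x d (m + 1)).eval c = 0) :
    ∃ r : K, IsIntegral ℤ r ∧ 1 - ζ = d * r := by
  obtain ⟨q1, q2⟩ := Q_monic x ζ d m n hd
  obtain ⟨b1, b2⟩ := itP_monic x d hd m
  set Q := itP x d (m + n + 2) - C ζ * itP x d (m + 1) with hQ
  have hroot : ∀ c, Q.IsRoot c → (itP x d (m + 1)).eval c = 0 ∧
      (itP x d (m + n + 2)).eval c = 0 := by
    intro c hc
    have h1 : (itP x d (m + n + 2)).eval c = ζ * (itP x d (m + 1)).eval c := by
      have := hc.eq_zero
      simp [hQ] at this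
      linear_combination this
    have h2 := H c h1
    exact ⟨h2, by rw [h1, h2, mul_zero]⟩
  have hex : ∃ c, Q.IsRoot c ∧ (derivative Q).IsRoot c := by
    by_contra hno
    push Not at hno
    have hnd : Q.roots.Nodup := by
      classical
      rw [Multiset.nodup_iff_count_le_one]
      intro a
      rw [count_roots]
      by_contra hgt
      push Not at hgt
      have := (one_lt_rootMultiplicity_iff_isRoot q1.ne_zero).1 hgt
      exact hno a this.1 this.2
    have hle : Q.roots ≤ (itP x d (m + 1)).roots := by
      rw [Multiset.le_iff_subset hnd]
      intro a ha
      rw [mem_roots b1.ne_zero]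
      exact (hroot a ((mem_roots q1.ne_zero).1 ha)).1
    have hc1 := Multiset.card_le_card hle
    have hc2 := card_roots' (itP x d (m + 1))
    have hc3 : Multiset.card Q.roots = Q.natDegree :=
      ((IsAlgClosed.splits Q).natDegree_eq_card_roots).symm
    have : d ^ m < d ^ (m + n + 1) := Nat.pow_lt_pow_right (by omega) (by omega)
    omega
  obtain ⟨c, hc, hc'⟩ := hex
  obtain ⟨h1, h2⟩ := hroot c hc
  obtain ⟨-, ic, ix⟩ := bad_facts x c d m n hd h1 h2
  obtain ⟨r1, ir1, e1⟩ := (int_deriv x c d (m + n + 1) ix ic).2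
  obtain ⟨r2, ir2, e2⟩ := (int_deriv x c d m ix ic).2
  have e := hc'.eq_zero
  simp only [hQ, derivative_sub, derivative_C_mul, eval_sub, eval_mul, eval_C] at e
  rw [show m + n + 2 = m + n + 1 + 1 by ring, e1, e2] at e
  exact ⟨ζ * r2 - r1, (hz.mul ir2).sub ir1, by linear_combination e⟩


lemma case_ge3 (x : K) (d m n : ℕ) (hd : 3 ≤ d)
    (H : ∀ ζ : K, ζ ^ d = 1 → ζ ≠ 1 → ∀ c : K,
      (itP x d (m + n + 2)).eval c = ζ * (itP x d (m + 1)).eval c →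
      (itP x d (m + 1)).eval c = 0) : False := by
  obtain ⟨e, rfl⟩ : ∃ e, d = e + 3 := ⟨d - 3, by omega⟩
  have : NeZero ((e + 3 : ℕ) : K) := ⟨by exact_mod_cast (by omega : e + 3 ≠ 0)⟩
  obtain ⟨μ, hμ⟩ := HasEnoughRootsOfUnity.exists_primitiveRoot K (e + 3)
  have hprod := hμ.prod_one_sub_pow_eq_order
  have hint : IsIntegral ℤ μ := hμ.isIntegral (by omega)
  have hr : ∀ k ∈ Finset.range (e + 2), ∃ r : K, IsIntegral ℤ r ∧
      1 - μ ^ (k + 1) = ((e + 3 : ℕ) : K) * r := by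
    intro k hk
    rw [Finset.mem_range] at hk
    refine d_dvd x _ (e + 3) m n (by omega) (hint.pow _) (H _ ?_ ?_)
    · rw [← pow_mul, mul_comm, pow_mul, hμ.pow_eq_one, one_pow]
    · exact hμ.pow_ne_one_of_pos_of_lt (by omega) (by omega)
  choose! r ir er using hr
  rw [Finset.prod_congr rfl er, Finset.prod_mul_distrib, Finset.prod_const, Finset.card_range]
    at hprod
  have hd0 : ((e + 3 : ℕ) : K) ≠ 0 := this.out
  have hdI : IsIntegral ℤ ((e + 3 : ℕ) : K) := by
    simpa using (isIntegral_algebraMap (R := ℤ) (A := K) (x := ((e + 3 : ℕ) : ℤ)))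
  refine not_int_inv (K := K) (e + 3) (by omega)
    (((e + 3 : ℕ) : K) ^ e * ∏ k ∈ Finset.range (e + 2), r k)
    ((hdI.pow e).mul (IsIntegral.prod _ ir)) ?_
  apply mul_left_cancel₀ hd0
  push_cast at hprod ⊢
  linear_combination hprod

lemma inv_eval_zero (F : K[X]) (hF : F.Monic)
    (h : ∀ s, F.IsRoot s → s ≠ 0 ∧ IsIntegral ℤ s⁻¹) :
    F.eval 0 ≠ 0 ∧ IsIntegral ℤ (F.eval 0)⁻¹ := by
  have h' : ∀ s ∈ F.roots, s ≠ 0 ∧ IsIntegral ℤ s⁻¹ :=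
    fun s hs => h s ((mem_roots hF.ne_zero).1 hs)
  have e : F = (F.roots.map (fun a => X - C a)).prod :=
    (IsAlgClosed.splits F).eq_prod_roots_of_monic hF
  have gen : ∀ S : Multiset K, (∀ s ∈ S, s ≠ 0 ∧ IsIntegral ℤ s⁻¹) →
      ((S.map (fun a => X - C a)).prod).eval 0 ≠ 0 ∧
      IsIntegral ℤ (((S.map (fun a => X - C a)).prod).eval 0)⁻¹ := by
    intro S
    induction S using Multiset.induction with
    | empty => intro _; simpa using isIntegral_one
    | cons a S ih =>
      intro hS
      obtain ⟨i1, i2⟩ := ih (fun s hs => hS s (Multiset.mem_cons_of_mem hs))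
      obtain ⟨a1, a2⟩ := hS a (Multiset.mem_cons_self a S)
      rw [Multiset.map_cons, Multiset.prod_cons, eval_mul]
      simp only [eval_sub, eval_X, eval_C, zero_sub]
      refine ⟨mul_ne_zero (neg_ne_zero.2 a1) i1, ?_⟩
      rw [mul_inv, inv_neg]
      exact a2.neg.mul i2
  rw [e]
  exact gen _ h'

lemma inv_int (c : K) (n : ℕ) (hc : IsIntegral ℤ c) (hc0 : c ≠ 0)
    (h : (fun z : K => z ^ 2 + c)^[n + 1] 0 = 0) : IsIntegral ℤ c⁻¹ := by
  have key : ∀ k, ∃ r : K, IsIntegral ℤ r ∧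
      (fun z : K => z ^ 2 + c)^[k + 1] 0 = c * (1 + c * r) := by
    intro k
    induction k with
    | zero => exact ⟨0, isIntegral_zero, by simp⟩
    | succ k ih =>
      obtain ⟨r, ir, e⟩ := ih
      refine ⟨(1 + c * r) ^ 2, (isIntegral_one.add (hc.mul ir)).pow 2, ?_⟩
      rw [iterate_succ_apply', e]; ring
  obtain ⟨r, ir, e⟩ := key n
  rw [h] at e
  have h1 : 1 + c * r = 0 := by
    rcases mul_eq_zero.1 e.symm with h | h
    · exact absurd h hc0
    · exact h
  have : c⁻¹ = -r := by
    field_simp; linear_combination h1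
  rw [this]; exact ir.neg

lemma cong2 (x c : K) (k : ℕ) (hx : IsIntegral ℤ x) (hc : IsIntegral ℤ c) :
    ∃ r : K, IsIntegral ℤ r ∧ (fun z : K => z ^ 2 + c)^[k] x =
      (fun z : K => z ^ 2 + c)^[k] 0 + x ^ 2 ^ k + 2 * r := by
  have h2 : IsIntegral ℤ (2 : K) := by
    simpa using (isIntegral_algebraMap (R := ℤ) (A := K) (x := (2 : ℤ)))
  induction k with
  | zero => exact ⟨0, isIntegral_zero, by simp⟩
  | succ k ih =>
    obtain ⟨r, ir, e⟩ := ih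
    have hg := int_iter 0 c 2 k isIntegral_zero hc
    rw [iterate_succ_apply', iterate_succ_apply', e]
    set g := (fun z : K => z ^ 2 + c)^[k] 0
    refine ⟨g * x ^ 2 ^ k + 2 * (r * (g + x ^ 2 ^ k + r)), ?_, ?_⟩
    · exact (hg.mul (hx.pow _)).add (h2.mul (ir.mul ((hg.add (hx.pow _)).add ir)))
    · rw [pow_succ 2 k, pow_mul]; ring

lemma itP_eval_zero (x : K) (k : ℕ) : (itP x 2 k).eval 0 = x ^ 2 ^ k := by
  induction k with
  | zero => simp [itP]
  | succ k ih => simp [itP, ih, pow_succ 2 k, pow_mul]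

lemma case_two (x : K) (m n : ℕ)
    (H : ∀ c : K, (itP x 2 (m + n + 2)).eval c = (-1) * (itP x 2 (m + 1)).eval c →
      (itP x 2 (m + 1)).eval c = 0) : False := by
  obtain ⟨q1, q2⟩ := Q_monic x (-1) 2 m n le_rfl
  set Q := itP x 2 (m + n + 2) - C (-1) * itP x 2 (m + 1) with hQ
  have hroot : ∀ c, Q.IsRoot c → (itP x 2 (m + 1)).eval c = 0 ∧
      (itP x 2 (m + n + 2)).eval c = 0 := by
    intro c hc
    have h1 : (itP x 2 (m + n + 2)).eval c = (-1) * (itP x 2 (m + 1)).eval c := by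
      have := hc.eq_zero
      simp [hQ] at this
      linear_combination this
    have h2 := H c h1
    exact ⟨h2, by rw [h1, h2, mul_zero]⟩
  have hinv : ∀ s, Q.IsRoot s → s ≠ 0 → IsIntegral ℤ s⁻¹ := by
    intro s hs hs0
    obtain ⟨h1, h2⟩ := hroot s hs
    obtain ⟨h3, ic, ix⟩ := bad_facts x s 2 m n le_rfl h1 h2
    exact inv_int s n ic hs0 h3
  by_cases hx : x = 0
  · subst hx
    have hQ0 : Q.eval 0 = 0 := by simp [hQ, itP_eval_zero]
    obtain ⟨W, hW⟩ : X ∣ Q := by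
      rw [X_dvd_iff, coeff_zero_eq_eval_zero]; exact hQ0
    have hWm : W.Monic := monic_X.of_mul_monic_left (hW ▸ q1)
    have hd1 : ∀ k, (derivative (itP (0 : K) 2 (k + 1))).eval 0 = 1 := by
      intro k
      simp [itP, derivative_pow, itP_eval_zero]
    have hW0 : W.eval 0 = 2 := by
      have e1 : (derivative Q).eval 0 = W.eval 0 := by rw [hW]; simp
      rw [← e1, hQ]
      simp only [derivative_sub, derivative_C_mul, eval_sub, eval_mul, eval_C]
      rw [show m + n + 2 = m + n + 1 + 1 by ring, hd1, hd1]; norm_num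
    have := inv_eval_zero W hWm (by
      intro s hs
      have hs0 : s ≠ 0 := by
        rintro rfl
        rw [IsRoot.def, hW0] at hs
        exact two_ne_zero hs
      exact ⟨hs0, hinv s (by rw [hW, IsRoot.def, eval_mul, hs.eq_zero, mul_zero]) hs0⟩)
    rw [hW0] at this
    exact not_int_inv 2 le_rfl _ this.2 (by norm_num)
  · obtain ⟨u1, u2⟩ := inv_eval_zero Q q1 (by
      intro s hs
      have hs0 : s ≠ 0 := by
        rintro rfl
        have := (hroot 0 hs).1
        rw [itP_eval_zero] at this
        exact pow_ne_zero _ hx this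
      exact ⟨hs0, hinv s hs hs0⟩)
    have hdeg : Q.degree ≠ 0 := by
      rw [degree_eq_natDegree q1.ne_zero, q2]
      exact_mod_cast (pow_ne_zero _ (by norm_num))
    obtain ⟨c, hc⟩ := IsAlgClosed.exists_root Q hdeg
    obtain ⟨h1, h2⟩ := hroot c hc
    obtain ⟨h3, ic, ix⟩ := bad_facts x c 2 m n le_rfl h1 h2
    rw [itP_eval] at h1 h2
    obtain ⟨r1, ir1, e1⟩ := cong2 x c (m + 1) ix ic
    obtain ⟨r2, ir2, e2⟩ := cong2 x c (m + n + 2) ix ic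
    have hg := int_iter 0 c 2 (m + 1) isIntegral_zero ic
    have hgg : (fun z : K => z ^ 2 + c)^[m + n + 2] 0 = (fun z : K => z ^ 2 + c)^[m + 1] 0 := by
      rw [show m + n + 2 = (m + 1) + (n + 1) by ring, iterate_add_apply, h3]
    rw [h1] at e1
    rw [h2, hgg] at e2
    set g := (fun z : K => z ^ 2 + c)^[m + 1] 0
    have hQ0 : Q.eval 0 = 2 * (-(g + r1 + r2)) := by
      simp only [hQ, eval_sub, eval_mul, eval_C, itP_eval_zero]
      linear_combination -e1 - e2
    refine not_int_inv 2 le_rfl (-(g + r1 + r2) * (Q.eval 0)⁻¹)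
      (((hg.add ir1).add ir2).neg.mul u2) ?_
    push_cast
    rw [← mul_assoc, ← hQ0, mul_inv_cancel₀ u1]

end aux

/-- If `M ≥ 1`, `(x,M) ≠ (0,1)`, and `(x,M,N,d)` is neither `(1,2,2,2)` nor `(-1,2,2,2)`,
then there is `c ∈ K` such that `f_{d,c}^{M+N}(x) = f_{d,c}^M(x)` and `x` has preperiod
exactly `M` under `f_{d,c}` (so eventual period dividing `N`). -/
theorem exists_c_exact_preperiod (K : Type*) [Field K] [IsAlgClosed K] [CharZero K]
    (x : K) (M N d : ℕ) (hM : 1 ≤ M) (hN : 1 ≤ N) (hd : 2 ≤ d)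
    (h1 : ¬(x = 0 ∧ M = 1))
    (h2 : ¬(x = 1 ∧ M = 2 ∧ N = 2 ∧ d = 2))
    (h3 : ¬(x = -1 ∧ M = 2 ∧ N = 2 ∧ d = 2)) :
    ∃ c : K, (fun z : K => z ^ d + c)^[M + N] x = (fun z : K => z ^ d + c)^[M] x ∧
      ∀ m n : ℕ, 0 < n →
        (fun z : K => z ^ d + c)^[m + n] x = (fun z : K => z ^ d + c)^[m] x → M ≤ m := by
  obtain ⟨n, rfl⟩ : ∃ n, N = n + 1 := ⟨N - 1, by omega⟩
  have hdK : NeZero (d : K) := ⟨by exact_mod_cast (by omega : d ≠ 0)⟩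
  obtain ⟨μ, hμ⟩ := HasEnoughRootsOfUnity.exists_primitiveRoot K d
  have hμ1 : μ ≠ 1 := hμ.ne_one (by omega)
  obtain rfl | ⟨m, rfl⟩ : M = 1 ∨ ∃ m, M = m + 1 + 1 := by
    rcases Nat.lt_or_ge M 2 with h | h
    · left; omega
    · right; exact ⟨M - 2, by omega⟩
  · have hx : x ≠ 0 := fun h => h1 ⟨h, rfl⟩
    obtain ⟨a1, a2⟩ := itP_monic x d hd n
    have hlt : (C (μ * x)).natDegree < (itP x d (n + 1)).natDegree := by
      rw [a2, natDegree_C]; positivity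
    have hm := a1.sub_of_left (degree_lt_degree hlt)
    have hdeg : (itP x d (n + 1) - C (μ * x)).degree ≠ 0 := by
      rw [degree_eq_natDegree hm.ne_zero, natDegree_sub_eq_left_of_natDegree_lt hlt, a2]
      exact_mod_cast (pow_ne_zero _ (by omega))
    obtain ⟨c, hc⟩ := IsAlgClosed.exists_root _ hdeg
    rw [IsRoot.def, eval_sub, eval_C, itP_eval, sub_eq_zero] at hc
    exact ⟨c, final_step x c μ d 0 (n + 1) hμ.pow_eq_one hμ1 (by rw [zero_add]; exact hc) hx⟩
  · suffices hS : ∃ ζ : K, ζ ^ d = 1 ∧ ζ ≠ 1 ∧ ∃ c : K,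
        (itP x d (m + n + 2)).eval c = ζ * (itP x d (m + 1)).eval c ∧
        (itP x d (m + 1)).eval c ≠ 0 by
      obtain ⟨ζ, z1, z2, c, c1, c2⟩ := hS
      rw [itP_eval] at c1 c2
      rw [itP_eval] at c1
      refine ⟨c, final_step x c ζ d (m + 1) (n + 1) z1 z2 ?_ c2⟩
      rw [show m + 1 + (n + 1) = m + n + 2 by ring]
      exact c1
    by_contra hno
    push Not at hno
    rcases Nat.lt_or_ge d 3 with h | h
    · obtain rfl : d = 2 := by omega
      exact case_two x m n (hno (-1) (by norm_num) (by norm_num))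
    · exact case_ge3 x d m n h hno
end
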